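/- arXiv:math/0611503 — 3 statements merged into one kernel-verified Lean document; each statement's English description precedes it below -/
import Mathlib

section
/- For each degree L, there exists a zonal function g_L ∈ L¹(S^d) with ‖g_L‖₁ ≤ C (C independent of L) such that the convolution operator T f = g_L ∗ f maps L^p(S^d) to L^p(S^d) with norm ≤ C for every 1 ≤ p ≤ ∞, T restricted to Π_L is the identity, and the range of T acting on spherical polynomials is contained in Π_{3L}. -/
open MeasureTheory MvPolynomial
open scoped RealInnerProductSpace ENNReal

noncomputable section

abbrev Esp (d : ℕ) : Type := EuclideanSpace ℝ (Fin (d+1))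

abbrev Sph (d : ℕ) := Metric.sphere (0 : Esp d) 1

/-- The surface measure on the unit sphere `S^d`. -/
def sphMeasure (d : ℕ) : Measure (Sph d) := (volume : Measure (Esp d)).toSphere

/-- The Laplacian on polynomials in `d+1` variables. -/
def polyLap (d : ℕ) : MvPolynomial (Fin (d+1)) ℝ →ₗ[ℝ] MvPolynomial (Fin (d+1)) ℝ :=
  ∑ i : Fin (d+1), ((pderiv i).toLinearMap ∘ₗ (pderiv i).toLinearMap)

/-- Homogeneous harmonic polynomials of degree `ℓ` in `d+1` variables. -/
def harmHomog (d ℓ : ℕ) : Submodule ℝ (MvPolynomial (Fin (d+1)) ℝ) :=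
  homogeneousSubmodule (Fin (d+1)) ℝ ℓ ⊓ LinearMap.ker (polyLap d)

/-- Restriction of polynomials to the unit sphere, as a linear map. -/
def restrictSph (d : ℕ) : MvPolynomial (Fin (d+1)) ℝ →ₗ[ℝ] (Sph d → ℝ) where
  toFun P := fun x => eval (fun i => (x : Esp d) i) P
  map_add' P Q := by funext x; simp
  map_smul' r P := by funext x; simp [smul_eval]

/-- Spherical harmonics of degree `ℓ` on `S^d`. -/
def Hsp (d ℓ : ℕ) : Submodule ℝ (Sph d → ℝ) := (harmHomog d ℓ).map (restrictSph d)

/-- Spherical harmonics of degree at most `L` on `S^d`. -/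
def PiSp (d L : ℕ) : Submodule ℝ (Sph d → ℝ) := ⨆ ℓ : Fin (L+1), Hsp d ℓ

/-- Sums of homogeneous harmonic polynomials of degrees `≤ L` :
polynomial (harmonic-extension) model of `Π_L`. -/
def harmPolyLe (d L : ℕ) : Submodule ℝ (MvPolynomial (Fin (d+1)) ℝ) :=
  ⨆ ℓ : Fin (L+1), harmHomog d ℓ

/-- The north pole of `S^d`. -/
def north (d : ℕ) : Sph d :=
  ⟨EuclideanSpace.single 0 1, by
    simp [mem_sphere_zero_iff_norm, EuclideanSpace.norm_single]⟩

/-- The geodesic distance on `S^d`. -/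
def gdist (d : ℕ) (x y : Sph d) : ℝ := Real.arccos ⟪(x : Esp d), (y : Esp d)⟫

def fisch (d : ℕ) : MvPolynomial (Fin (d+1)) ℝ →ₗ[ℝ] MvPolynomial (Fin (d+1)) ℝ →ₗ[ℝ] ℝ :=
  (basisMonomials (Fin (d+1)) ℝ).constr ℝ
    (fun m => (((∏ i, (m i).factorial : ℕ) : ℝ) • lcoeff ℝ m))

lemma fisch_monomial (d : ℕ) (m : Fin (d+1) →₀ ℕ) (a : ℝ) (q : MvPolynomial (Fin (d+1)) ℝ) :
    fisch d (monomial m a) q = a * (((∏ i, (m i).factorial : ℕ) : ℝ) * coeff m q) := by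
  have h : monomial m a = a • basisMonomials (Fin (d+1)) ℝ m := by
    simp [smul_monomial]
  rw [h, map_smul, fisch, Module.Basis.constr_basis]
  simp

lemma fisch_X (d : ℕ) (i : Fin (d+1)) (p q : MvPolynomial (Fin (d+1)) ℝ) :
    fisch d (X i * p) q = fisch d p (pderiv i q) := by
  induction p using MvPolynomial.induction_on' with
  | monomial m a =>
    have : X i * monomial m a = monomial (m + Finsupp.single i 1) a := by
      rw [X, monomial_mul, one_mul, add_comm (Finsupp.single i 1) m]
    rw [this, fisch_monomial, fisch_monomial, coeff_pderiv]
    have : (∏ j, ((m + Finsupp.single i 1 : Fin (d+1) →₀ ℕ) j).factorial) = (∏ j, (m j).factorial) * (m i + 1) := by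
      rw [← Finset.mul_prod_erase _ _ (Finset.mem_univ i), ← Finset.mul_prod_erase _ (fun j => (m j).factorial) (Finset.mem_univ i)]
      have : ∏ x ∈ Finset.univ.erase i, ((m + Finsupp.single i 1 : Fin (d+1) →₀ ℕ) x).factorial = ∏ x ∈ Finset.univ.erase i, (m x).factorial := by
        apply Finset.prod_congr rfl
        intro x hx
        have : i ≠ x := (Finset.ne_of_mem_erase hx).symm
        simp [this]
      rw [this]
      simp [Nat.factorial_succ]
      ring
    rw [this]; push_cast; ring
  | add f g h1 h2 =>
    rw [mul_add, map_add, map_add, LinearMap.add_apply, LinearMap.add_apply, h2, h1]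

lemma fisch_self (d : ℕ) (p : MvPolynomial (Fin (d+1)) ℝ) (h : fisch d p p = 0) : p = 0 := by
  have h1 : fisch d p p = ∑ m ∈ p.support, coeff m p * (((∏ i, (m i).factorial : ℕ) : ℝ) * coeff m p) := by
    have h2 : ∀ q, fisch d p q = ∑ m ∈ p.support, fisch d (monomial m (coeff m p)) q := by
      intro q
      conv_lhs => rw [p.as_sum]
      rw [map_sum, LinearMap.sum_apply]
    rw [h2]
    apply Finset.sum_congr rfl
    intro m _
    rw [fisch_monomial]
  rw [h1, Finset.sum_eq_zero_iff_of_nonneg] at h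
  · by_contra hp
    obtain ⟨m, hm⟩ := Finset.nonempty_iff_ne_empty.mpr (mt support_eq_empty.mp hp)
    have := h m hm
    have h2 := mem_support_iff.mp hm
    have h3 : ((∏ i, (m i).factorial : ℕ) : ℝ) ≠ 0 := by
      exact_mod_cast Finset.prod_ne_zero_iff.mpr (fun i _ => Nat.factorial_ne_zero _)
    simp only [mul_eq_zero] at this
    tauto
  · intro m _
    have : 0 ≤ ((∏ i, (m i).factorial : ℕ) : ℝ) := Nat.cast_nonneg _
    nlinarith [mul_nonneg this (mul_self_nonneg (coeff m p))]

def rsq (d : ℕ) : MvPolynomial (Fin (d+1)) ℝ := ∑ i, X i * X i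

lemma fisch_rsq (d : ℕ) (p q : MvPolynomial (Fin (d+1)) ℝ) :
    fisch d (rsq d * p) q = fisch d p (polyLap d q) := by
  simp only [rsq, polyLap, Finset.sum_mul, map_sum, LinearMap.sum_apply, mul_assoc, fisch_X]
  rfl

lemma rsq_homog (d : ℕ) : (rsq d).IsHomogeneous 2 := by
  apply IsHomogeneous.sum
  intro i _
  exact (isHomogeneous_X ℝ i).mul (isHomogeneous_X ℝ i)

lemma rsq_ne (d : ℕ) : rsq d ≠ 0 := by
  intro h
  have := congrArg (eval (fun _ => (1:ℝ))) h
  simp [rsq] at this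
  linarith

lemma polyLap_homog (d n : ℕ) (p : MvPolynomial (Fin (d+1)) ℝ) (h : p.IsHomogeneous (n+2)) :
    (polyLap d p).IsHomogeneous n := by
  simp only [polyLap, LinearMap.sum_apply]
  apply IsHomogeneous.sum
  intro i _
  exact (h.pderiv (i := i)).pderiv (i := i)

lemma lap_surj (d n : ℕ) (p : MvPolynomial (Fin (d+1)) ℝ) (h : p.IsHomogeneous n) :
    ∃ q : MvPolynomial (Fin (d+1)) ℝ, q.IsHomogeneous n ∧ polyLap d (rsq d * q) = p := by
  let T : homogeneousSubmodule (Fin (d+1)) ℝ n →ₗ[ℝ] homogeneousSubmodule (Fin (d+1)) ℝ n :=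
    ((polyLap d ∘ₗ LinearMap.mulLeft ℝ (rsq d)).restrict (p := homogeneousSubmodule (Fin (d+1)) ℝ n)
      (q := homogeneousSubmodule (Fin (d+1)) ℝ n) (by
      intro q hq
      rw [mem_homogeneousSubmodule] at hq ⊢
      apply polyLap_homog
      have := (rsq_homog d).mul hq
      rwa [add_comm 2 n] at this))
  have hinj : Function.Injective T := by
    rw [injective_iff_map_eq_zero]
    intro q hq
    have hq' : polyLap d (rsq d * q.1) = 0 := congrArg Subtype.val hq
    have h2 : fisch d (rsq d * q.1) (rsq d * q.1) = 0 := by rw [fisch_rsq, hq', map_zero]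
    have h3 := fisch_self _ _ h2
    have := (mul_eq_zero.mp h3).resolve_left (rsq_ne d)
    exact Subtype.ext this
  have : FiniteDimensional ℝ (homogeneousSubmodule (Fin (d+1)) ℝ n) := by
    apply Submodule.finiteDimensional_of_le (S₂ := restrictTotalDegree (Fin (d+1)) ℝ n)
    intro q hq
    rw [mem_restrictTotalDegree]
    exact IsHomogeneous.totalDegree_le hq
  obtain ⟨q, hq⟩ := LinearMap.injective_iff_surjective.mp hinj ⟨p, h⟩
  exact ⟨q.1, q.2, congrArg Subtype.val hq⟩

lemma PiSp_mono (d : ℕ) {m n : ℕ} (h : m ≤ n) : PiSp d m ≤ PiSp d n := by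
  apply iSup_le
  intro l
  exact le_iSup (fun l : Fin (n+1) => Hsp d l) ⟨l.1, by omega⟩

lemma restrict_rsq (d : ℕ) (q : MvPolynomial (Fin (d+1)) ℝ) :
    restrictSph d (rsq d * q) = restrictSph d q := by
  funext x
  have hx : ‖(x : Esp d)‖ = 1 := by simp
  have h2 : ∑ i, (x : Esp d) i * (x : Esp d) i = 1 := by
    have := EuclideanSpace.real_norm_sq_eq (x : Esp d)
    rw [hx] at this
    simp only [← sq]
    linarith
  simp [restrictSph, rsq, h2]

lemma homog_mem_PiSp (d n : ℕ) : ∀ (p : MvPolynomial (Fin (d+1)) ℝ), p.IsHomogeneous n →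
    restrictSph d p ∈ PiSp d n := by
  induction n using Nat.strong_induction_on with
  | _ n ih =>
  intro p hp
  have key : ∀ h : MvPolynomial (Fin (d+1)) ℝ, h.IsHomogeneous n → polyLap d h = 0 →
      restrictSph d h ∈ PiSp d n := by
    intro h h1 h2
    refine (le_iSup (fun l : Fin (n+1) => Hsp d l) ⟨n, by omega⟩) ?_
    exact ⟨h, ⟨h1, h2⟩, rfl⟩
  by_cases hn : n < 2
  · apply key p hp
    simp only [polyLap, LinearMap.sum_apply]
    apply Finset.sum_eq_zero
    intro i _
    have h1 : (pderiv i p).IsHomogeneous 0 := by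
      have := hp.pderiv (i := i)
      have h : n - 1 = 0 := by omega
      rwa [h] at this
    have h2 := totalDegree_eq_zero_iff_eq_C.mp (Nat.le_zero.mp h1.totalDegree_le)
    change pderiv i (pderiv i p) = 0
    rw [h2, pderiv_C]
  · obtain ⟨k, rfl⟩ : ∃ k, n = k + 2 := ⟨n - 2, by omega⟩
    obtain ⟨q, hq, hq2⟩ := lap_surj d k _ (polyLap_homog d k p hp)
    have h1 : p = (p - rsq d * q) + rsq d * q := by ring
    rw [h1, map_add, restrict_rsq]
    refine Submodule.add_mem _ (key _ ?_ ?_) (PiSp_mono d (by omega) (ih k (by omega) q hq))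
    · have := (rsq_homog d).mul hq
      rw [add_comm 2 k] at this
      exact hp.sub this
    · rw [map_sub, hq2, sub_self]

def Rsp (d n : ℕ) : Submodule ℝ (Sph d → ℝ) :=
  (restrictTotalDegree (Fin (d+1)) ℝ n).map (restrictSph d)

lemma PiSp_eq (d n : ℕ) : PiSp d n = Rsp d n := by
  apply le_antisymm
  · apply iSup_le
    intro l
    apply Submodule.map_mono
    intro q hq
    rw [mem_restrictTotalDegree]
    exact (IsHomogeneous.totalDegree_le hq.1).trans (by omega)
  · rintro _ ⟨p, hp, rfl⟩
    rw [SetLike.mem_coe, mem_restrictTotalDegree] at hp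
    rw [← p.sum_homogeneousComponent, map_sum]
    apply Submodule.sum_mem
    intro i hi
    rw [Finset.mem_range] at hi
    exact PiSp_mono d (by omega) (homog_mem_PiSp d i _ (homogeneousComponent_isHomogeneous i p))

lemma Rsp_mul (d : ℕ) {m n : ℕ} {f g : Sph d → ℝ} (hf : f ∈ Rsp d m) (hg : g ∈ Rsp d n) :
    (fun x => f x * g x) ∈ Rsp d (m+n) := by
  obtain ⟨p, hp, rfl⟩ := hf
  obtain ⟨q, hq, rfl⟩ := hg
  rw [SetLike.mem_coe, mem_restrictTotalDegree] at hp hq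
  refine ⟨p * q, ?_, ?_⟩
  · rw [SetLike.mem_coe, mem_restrictTotalDegree]
    exact (totalDegree_mul _ _).trans (by omega)
  · funext x
    simp [restrictSph]

lemma Rsp_cont (d : ℕ) {n : ℕ} {f : Sph d → ℝ} (hf : f ∈ Rsp d n) : Continuous f := by
  obtain ⟨p, -, rfl⟩ := hf
  simp only [restrictSph, LinearMap.coe_mk, AddHom.coe_mk]
  refine (MvPolynomial.continuous_eval p).comp ?_
  fun_prop

instance (d n : ℕ) : FiniteDimensional ℝ (Rsp d n) := by
  unfold Rsp; infer_instance

def mfun (d : ℕ) (a : ℕ) (m : Fin d → ℕ) : Sph d → ℝ :=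
  fun x => (x : Esp d) 0 ^ a * ∏ i : Fin d, (x : Esp d) i.succ ^ m i

lemma restrict_rename_monomial (d : ℕ) (m : Fin d →₀ ℕ) :
    restrictSph d (rename Fin.succ (monomial m 1)) = mfun d 0 m := by
  funext x
  simp only [restrictSph, mfun, LinearMap.coe_mk, AddHom.coe_mk, eval_rename, eval_monomial,
    pow_zero, one_mul]
  rw [Finsupp.prod_fintype _ _ (by simp)]
  rfl

lemma restrict_monomial (d : ℕ) (m : Fin (d+1) →₀ ℕ) (c : ℝ) :
    restrictSph d (monomial m c) = c • mfun d (m 0) (fun i => m i.succ) := by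
  funext x
  simp only [restrictSph, mfun, LinearMap.coe_mk, AddHom.coe_mk, eval_monomial, Pi.smul_apply,
    smul_eq_mul]
  rw [Finsupp.prod_fintype _ _ (by simp), Fin.prod_univ_succ]

abbrev Sidx (d n : ℕ) := {m : Fin d → ℕ // ∑ i, m i ≤ n}

instance (d n : ℕ) : Finite (Sidx d n) := by
  refine Set.Finite.subset (s := Set.Iic (fun _ => n)) (Set.finite_Iic _) ?_
  intro m hm i
  exact (Finset.single_le_sum (f := m) (fun _ _ => Nat.zero_le _) (Finset.mem_univ i)).trans hm

lemma restrict_rename_inj (d : ℕ) :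
    LinearMap.ker (restrictSph d ∘ₗ (rename (R := ℝ) (Fin.succ : Fin d → Fin (d+1))).toLinearMap) = ⊥ := by
  rw [LinearMap.ker_eq_bot']
  intro p hp
  apply funext_set (fun _ => Set.Icc (0:ℝ) (1/((d:ℝ)+1)))
  · intro i
    exact Set.Icc_infinite (by positivity)
  intro y hy
  have hsum : ∑ i, y i ^ 2 ≤ 1 := by
    have h1 : ∀ i, y i ^ 2 ≤ 1/((d:ℝ)+1) := by
      intro i
      have := hy i (Set.mem_univ i)
      have h2 : 1/((d:ℝ)+1) ≤ 1 := by
        rw [div_le_one (by positivity)]; linarith [(Nat.cast_nonneg d : (0:ℝ) ≤ d)]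
      nlinarith [this.1, this.2]
    calc ∑ i, y i ^ 2 ≤ ∑ i : Fin d, 1/((d:ℝ)+1) := Finset.sum_le_sum (fun i _ => h1 i)
      _ = d / ((d:ℝ)+1) := by simp; rfl
      _ ≤ 1 := by rw [div_le_one (by positivity)]; linarith
  let z : Esp d := WithLp.toLp 2 (Fin.cons (Real.sqrt (1 - ∑ i, y i ^ 2)) y)
  have hz : ‖z‖ = 1 := by
    have h := EuclideanSpace.real_norm_sq_eq z
    rw [Fin.sum_univ_succ] at h
    simp only [z, Fin.cons_zero, Fin.cons_succ] at h
    rw [Real.sq_sqrt (by linarith)] at h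
    have h3 : ‖z‖ ^ 2 = 1 := by simp only [z]; linarith
    nlinarith [norm_nonneg z]
  have h := congrFun hp ⟨z, by simp [hz]⟩
  simp only [LinearMap.comp_apply, AlgHom.toLinearMap_apply, restrictSph, LinearMap.coe_mk,
    AddHom.coe_mk, eval_rename] at h
  rw [map_zero]
  have hy2 : ((fun i => z i) ∘ Fin.succ) = y := by
    funext i; simp [z]
  rw [hy2] at h
  exact h

lemma dim_lower (d n : ℕ) : Nat.card (Sidx d n) ≤ Module.finrank ℝ (Rsp d n) := by
  have : Fintype (Sidx d n) := Fintype.ofFinite _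
  have h1 : LinearIndependent ℝ (fun m : Sidx d n =>
      basisMonomials (Fin d) ℝ (Finsupp.equivFunOnFinite.symm m.1)) := by
    apply (basisMonomials (Fin d) ℝ).linearIndependent.comp
      (fun m : Sidx d n => Finsupp.equivFunOnFinite.symm m.1)
    intro a b hab
    exact Subtype.ext (Finsupp.equivFunOnFinite.symm.injective hab)
  have h2 := h1.map' _ (restrict_rename_inj d)
  have h3 := finrank_span_eq_card h2
  rw [Nat.card_eq_fintype_card, ← h3]
  apply Submodule.finrank_mono
  rw [Submodule.span_le]
  rintro _ ⟨m, rfl⟩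
  refine ⟨rename Fin.succ (basisMonomials (Fin d) ℝ (Finsupp.equivFunOnFinite.symm m.1)), ?_, rfl⟩
  rw [SetLike.mem_coe, mem_restrictTotalDegree]
  refine (totalDegree_rename_le _ _).trans ?_
  simp only [coe_basisMonomials]
  refine (totalDegree_monomial_le _ _).trans ?_
  rw [Finsupp.sum_fintype _ _ (by simp)]
  exact m.2

def ufam (d n : ℕ) (t : Fin 2 × (Fin d → Fin 2) × Sidx d n) : Sph d → ℝ :=
  mfun d t.1 (fun i => 2 * t.2.2.1 i + t.2.1 i)

lemma mfun_mem (d n : ℕ) (a : ℕ) : ∀ m : Fin d → ℕ, a + ∑ i, m i ≤ 2 * n →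
    mfun d a m ∈ Submodule.span ℝ (Set.range (ufam d n)) := by
  induction a using Nat.strong_induction_on with
  | _ a ih =>
  intro m hm
  by_cases ha : a < 2
  · apply Submodule.subset_span
    refine ⟨⟨⟨a, ha⟩, fun i => ⟨m i % 2, Nat.mod_lt _ (by norm_num)⟩, ⟨fun i => m i / 2, ?_⟩⟩, ?_⟩
    · have : 2 * ∑ i, m i / 2 ≤ ∑ i, m i := by
        rw [Finset.mul_sum]
        exact Finset.sum_le_sum (fun i _ => by omega)
      show ∑ i, m i / 2 ≤ n
      omega
    · simp only [ufam]
      congr 1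
      funext i
      exact Nat.div_add_mod _ _
  · obtain ⟨k, rfl⟩ : ∃ k, a = k + 2 := ⟨a - 2, by omega⟩
    have h : mfun d (k+2) m = mfun d k m - ∑ i, mfun d k (m + Pi.single i 2) := by
      funext x
      have hx : ‖(x : Esp d)‖ = 1 := by simp
      have h2 := EuclideanSpace.real_norm_sq_eq (x : Esp d)
      rw [hx, Fin.sum_univ_succ] at h2
      have h3 : ∀ i, mfun d k (m + Pi.single i 2) x = mfun d k m x * (x : Esp d) i.succ ^ 2 := by
        intro i
        simp only [mfun, Pi.add_apply, pow_add, Finset.prod_mul_distrib]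
        have : ∏ j : Fin d, (x : Esp d) j.succ ^ (Pi.single (M := fun _ => ℕ) i 2 j) = (x : Esp d) i.succ ^ 2 := by
          rw [Finset.prod_eq_single i]
          · simp
          · intro j _ hj; simp [hj]
          · simp
        rw [this]; ring
      rw [Pi.sub_apply, Finset.sum_apply, Finset.sum_congr rfl (fun i _ => h3 i), ← Finset.mul_sum]
      have h4 : ∑ i : Fin d, (x : Esp d) i.succ ^ 2 = 1 - (x : Esp d) 0 ^ 2 := by linarith
      rw [h4]
      simp only [mfun]
      ring
    rw [h]
    apply Submodule.sub_mem
    · exact ih k (by omega) m (by omega)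
    · apply Submodule.sum_mem
      intro i _
      apply ih k (by omega)
      simp only [Pi.add_apply, Finset.sum_add_distrib, Finset.sum_pi_single', Finset.mem_univ, if_true]
      omega

lemma Rsp_le_span (d n : ℕ) : Rsp d (2*n) ≤ Submodule.span ℝ (Set.range (ufam d n)) := by
  rintro _ ⟨p, hp, rfl⟩
  rw [SetLike.mem_coe, mem_restrictTotalDegree] at hp
  rw [p.as_sum, map_sum]
  apply Submodule.sum_mem
  intro m hm
  rw [restrict_monomial]
  apply Submodule.smul_mem
  apply mfun_mem
  have h1 := le_totalDegree hm
  rw [Finsupp.sum_fintype _ _ (by simp), Fin.sum_univ_succ] at h1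
  omega

lemma dim_bound (d n : ℕ) : Module.finrank ℝ (Rsp d (2*n)) ≤ 2^(d+1) * Module.finrank ℝ (Rsp d n) := by
  have : Fintype (Sidx d n) := Fintype.ofFinite _
  have h1 : Module.finrank ℝ (Rsp d (2*n)) ≤ Module.finrank ℝ (Submodule.span ℝ (Set.range (ufam d n))) := by
    have : FiniteDimensional ℝ (Submodule.span ℝ (Set.range (ufam d n))) :=
      FiniteDimensional.span_of_finite ℝ (Set.finite_range _)
    exact Submodule.finrank_mono (Rsp_le_span d n)
  have h2 := finrank_range_le_card (R := ℝ) (ufam d n)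
  have h3 := dim_lower d n
  rw [Nat.card_eq_fintype_card] at h3
  simp only [Set.finrank, Fintype.card_prod, Fintype.card_fin, Fintype.card_fun] at h2
  calc _ ≤ 2 * (2^d * Fintype.card (Sidx d n)) := h1.trans h2
    _ ≤ 2 * (2^d * Module.finrank ℝ (Rsp d n)) := by gcongr
    _ = _ := by ring

lemma dim_pos (d n : ℕ) : 0 < Module.finrank ℝ (Rsp d n) := by
  refine lt_of_lt_of_le ?_ (dim_lower d n)
  have : Nonempty (Sidx d n) := ⟨⟨fun _ => 0, by simp⟩⟩
  exact Nat.card_pos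

instance (d : ℕ) : IsFiniteMeasure (sphMeasure d) := by unfold sphMeasure; infer_instance
instance (d : ℕ) : (sphMeasure d).IsOpenPosMeasure := by unfold sphMeasure; infer_instance

lemma sph_integrable (d : ℕ) {f : Sph d → ℝ} (hf : Continuous f) : Integrable f (sphMeasure d) := by
  exact (hf.integrable_of_hasCompactSupport (HasCompactSupport.of_compactSpace f))

def rotS (d : ℕ) (U : Esp d ≃ₗᵢ[ℝ] Esp d) (x : Sph d) : Sph d :=
  ⟨U x, by simp⟩

lemma rotS_cont (d : ℕ) (U : Esp d ≃ₗᵢ[ℝ] Esp d) : Continuous (rotS d U) := by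
  unfold rotS
  exact Continuous.subtype_mk (U.continuous.comp continuous_subtype_val) _

open Pointwise in
lemma rotS_mp (d : ℕ) (U : Esp d ≃ₗᵢ[ℝ] Esp d) :
    MeasurePreserving (rotS d U) (sphMeasure d) (sphMeasure d) := by
  refine ⟨(rotS_cont d U).measurable, ?_⟩
  ext s hs
  rw [Measure.map_apply (rotS_cont d U).measurable hs]
  unfold sphMeasure
  rw [Measure.toSphere_apply' _ hs, Measure.toSphere_apply' _ ((rotS_cont d U).measurable hs)]
  congr 1
  rw [← U.measurePreserving.measure_preimage_emb U.toHomeomorph.measurableEmbedding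
    (Set.Ioo (0:ℝ) 1 • (Subtype.val '' s))]
  congr 1
  ext y
  simp only [Set.mem_preimage, Set.mem_smul, Set.mem_image]
  constructor
  · rintro ⟨r, hr, _, ⟨z, hz, rfl⟩, rfl⟩
    exact ⟨r, hr, _, ⟨rotS d U z, hz, rfl⟩, by simp [rotS]⟩
  · rintro ⟨r, hr, _, ⟨z, hz, rfl⟩, h⟩
    refine ⟨r, hr, _, ⟨rotS d U.symm z, ?_, rfl⟩, ?_⟩
    · have : rotS d U (rotS d U.symm z) = z := by ext1; simp [rotS]
      rw [this]; exact hz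
    · apply U.injective
      rw [← h]; simp [rotS]

def rotHomeo (d : ℕ) (U : Esp d ≃ₗᵢ[ℝ] Esp d) : Sph d ≃ₜ Sph d where
  toFun := rotS d U
  invFun := rotS d U.symm
  left_inv x := by ext1; simp [rotS]
  right_inv x := by ext1; simp [rotS]
  continuous_toFun := rotS_cont d U
  continuous_invFun := rotS_cont d U.symm

lemma rotS_integral (d : ℕ) (U : Esp d ≃ₗᵢ[ℝ] Esp d) (f : Sph d → ℝ) :
    ∫ x, f (rotS d U x) ∂(sphMeasure d) = ∫ x, f x ∂(sphMeasure d) :=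
  (rotS_mp d U).integral_comp (rotHomeo d U).measurableEmbedding f

lemma exists_rot (d : ℕ) (x y x' y' : Sph d)
    (h : ⟪(x : Esp d), (y : Esp d)⟫ = ⟪(x' : Esp d), (y' : Esp d)⟫) :
    ∃ U : Esp d ≃ₗᵢ[ℝ] Esp d, rotS d U x = x' ∧ rotS d U y = y' := by
  let U1 := Submodule.reflection (ℝ ∙ ((x : Esp d) - x'))ᗮ
  have h1 : U1 x = x' := Submodule.reflection_sub (by simp)
  let U2 := Submodule.reflection (ℝ ∙ (U1 (y : Esp d) - y'))ᗮ
  have h2 : U2 (U1 y) = y' := Submodule.reflection_sub (by simp)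
  have h3 : U2 x' = x' := by
    apply Submodule.reflection_mem_subspace_eq_self
    rw [Submodule.mem_orthogonal_singleton_iff_inner_left, inner_sub_right, ← h]
    rw [← h1, LinearIsometryEquiv.inner_map_map, sub_self]
  refine ⟨U1.trans U2, ?_, ?_⟩
  · ext1; simp [rotS, h1, h3]
  · ext1; simp [rotS, h2]

lemma Rsp_rot (d n : ℕ) (U : Esp d ≃ₗᵢ[ℝ] Esp d) {f : Sph d → ℝ} (hf : f ∈ Rsp d n) :
    (fun x => f (rotS d U x)) ∈ Rsp d n := by
  obtain ⟨p, hp, rfl⟩ := hf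
  rw [SetLike.mem_coe, mem_restrictTotalDegree] at hp
  let ℓ : Fin (d+1) → MvPolynomial (Fin (d+1)) ℝ := fun i =>
    ∑ j, C (U (EuclideanSpace.single j 1) i) * X j
  refine ⟨aeval ℓ p, ?_, ?_⟩
  · rw [SetLike.mem_coe, mem_restrictTotalDegree]
    have hℓ : ∀ i, (ℓ i).totalDegree ≤ 1 := by
      intro i
      apply (totalDegree_finsetSum _ _).trans
      apply Finset.sup_le
      intro j _
      apply (totalDegree_mul _ _).trans
      simp
    rw [p.as_sum, map_sum]
    apply (totalDegree_finsetSum _ _).trans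
    apply Finset.sup_le
    intro m hm
    rw [aeval_monomial]
    apply (totalDegree_mul _ _).trans
    rw [algebraMap_eq, totalDegree_C, zero_add]
    apply (totalDegree_finsetProd _ _).trans
    refine le_trans ?_ ((le_totalDegree hm).trans hp)
    apply Finset.sum_le_sum
    intro i _
    apply (totalDegree_pow _ _).trans
    nlinarith [hℓ i]
  · funext x
    simp only [restrictSph, LinearMap.coe_mk, AddHom.coe_mk]
    have h1 : ∀ v : Fin (d+1) → ℝ, eval v (aeval ℓ p) = eval (fun i => eval v (ℓ i)) p := by
      intro v
      have := eval₂Hom_bind₁ (RingHom.id ℝ) v ℓ p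
      exact this
    rw [h1]
    congr 2
    funext i
    have hx := (EuclideanSpace.basisFun (Fin (d+1)) ℝ).sum_repr (x : Esp d)
    have h2 := congrArg (fun z => (U z) i) hx
    simp only [map_sum, map_smul] at h2
    simp only [rotS, ℓ]
    rw [← h2]
    simp [mul_comm]

lemma exists_onb (d n : ℕ) : ∃ e : Fin (Module.finrank ℝ (Rsp d n)) → (Sph d → ℝ),
    (∀ i, e i ∈ Rsp d n) ∧ (∀ i, ∫ x, e i x * e i x ∂(sphMeasure d) = 1) ∧
    (∀ q ∈ Rsp d n, ∀ x, q x = ∑ i, (∫ y, e i y * q y ∂(sphMeasure d)) * e i x) := by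
  have hint : ∀ f g : Rsp d n, Integrable (fun x => f.1 x * g.1 x) (sphMeasure d) := fun f g =>
    sph_integrable d ((Rsp_cont d f.2).mul (Rsp_cont d g.2))
  let core : InnerProductSpace.Core ℝ (Rsp d n) :=
    { inner := fun f g => ∫ x, f.1 x * g.1 x ∂(sphMeasure d)
      conj_inner_symm := by
        intro f g
        simp [mul_comm]
      re_inner_nonneg := by
        intro f
        simp only [RCLike.re_to_real]
        exact integral_nonneg (fun x => mul_self_nonneg _)
      add_left := by
        intro f g h
        rw [← integral_add (hint f h) (hint g h)]
        simp [add_mul]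
      smul_left := by
        intro f g r
        simp only [conj_trivial]
        rw [← integral_const_mul]
        simp [mul_assoc]
      definite := by
        intro f hf
        have h1 := fun x => (Continuous.integral_pos_of_hasCompactSupport_nonneg_nonzero (μ := sphMeasure d) (x := x)
          (f := fun x => f.1 x * f.1 x) ((Rsp_cont d f.2).mul (Rsp_cont d f.2))
          (HasCompactSupport.of_compactSpace _) (fun x => mul_self_nonneg _))
        by_contra hne
        have : ∃ x, f.1 x ≠ 0 := by
          by_contra hall
          push Not at hall
          exact hne (Subtype.ext (funext hall))
        obtain ⟨x, hx⟩ := this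
        exact (h1 x (mul_self_ne_zero.mpr hx)).ne' hf }
  let : NormedAddCommGroup (Rsp d n) := core.toNormedAddCommGroup
  let : InnerProductSpace ℝ (Rsp d n) := InnerProductSpace.ofCore core.toCore
  let b := stdOrthonormalBasis ℝ (Rsp d n)
  refine ⟨fun i => (b i).1, fun i => (b i).2, ?_, ?_⟩
  · intro i
    have : inner ℝ (b i) (b i) = (1:ℝ) := by
      rw [real_inner_self_eq_norm_sq, b.orthonormal.1 i]; norm_num
    exact this
  · intro q hq x
    have h := b.sum_repr' ⟨q, hq⟩
    have h2 := congrArg (fun f : Rsp d n => f.1 x) h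
    simp only [Submodule.coe_sum, Finset.sum_apply, Submodule.coe_smul, Pi.smul_apply, smul_eq_mul] at h2
    exact h2.symm

lemma exists_kernel (d n : ℕ) : ∃ (e : Fin (Module.finrank ℝ (Rsp d n)) → (Sph d → ℝ))
    (K : Sph d → Sph d → ℝ),
    (∀ i, e i ∈ Rsp d n) ∧ (∀ x y, K x y = ∑ i, e i x * e i y) ∧
    (∀ q ∈ Rsp d n, ∀ x, ∫ y, K x y * q y ∂(sphMeasure d) = q x) ∧
    (∫ x, K x x ∂(sphMeasure d) = Module.finrank ℝ (Rsp d n)) := by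
  obtain ⟨e, h1, h2, h3⟩ := exists_onb d n
  refine ⟨e, fun x y => ∑ i, e i x * e i y, h1, fun _ _ => rfl, ?_, ?_⟩
  · intro q hq x
    rw [h3 q hq x]
    simp only [Finset.sum_mul]
    rw [integral_finset_sum]
    · apply Finset.sum_congr rfl
      intro i _
      simp only [mul_assoc]
      rw [integral_const_mul, mul_comm]
    · intro i _
      exact sph_integrable d ((continuous_const.mul (Rsp_cont d (h1 i))).mul (Rsp_cont d hq))
  · rw [integral_finset_sum]
    · simp [h2]
    · intro i _
      exact sph_integrable d ((Rsp_cont d (h1 i)).mul (Rsp_cont d (h1 i)))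

lemma kernel_inv (d n : ℕ) (K : Sph d → Sph d → ℝ) (hs : ∀ x y, K x y = K y x)
    (hK : ∀ x, K x ∈ Rsp d n)
    (hr : ∀ q ∈ Rsp d n, ∀ x, ∫ y, K x y * q y ∂(sphMeasure d) = q x)
    (U : Esp d ≃ₗᵢ[ℝ] Esp d) (x y : Sph d) : K (rotS d U x) (rotS d U y) = K x y := by
  have e1 := hr (fun z => K (rotS d U x) (rotS d U z)) (Rsp_rot d n U (hK _)) y
  have e2 := hr (fun w => K y (rotS d U.symm w)) (Rsp_rot d n U.symm (hK _)) (rotS d U x)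
  have hinv : ∀ z, rotS d U.symm (rotS d U z) = z := fun z => (rotHomeo d U).left_inv z
  rw [← rotS_integral d U] at e2
  simp only [hinv] at e2
  rw [hs x y, ← e1, ← e2]
  congr 1
  funext z
  ring

lemma exists_G (d : ℕ) : ∃ C : ℝ, 0 < C ∧ ∀ L : ℕ, ∃ G : Sph d → Sph d → ℝ,
    Continuous (Function.uncurry G) ∧ (∀ x y, G x y = G y x) ∧
    (∀ x y x' y' : Sph d, ⟪(x : Esp d), (y : Esp d)⟫ = ⟪(x' : Esp d), (y' : Esp d)⟫ → G x y = G x' y') ∧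
    (∀ x, ∫ y, |G x y| ∂(sphMeasure d) ≤ C) ∧
    (∀ q ∈ Rsp d L, ∀ x, ∫ y, G x y * q y ∂(sphMeasure d) = q x) ∧
    (∀ f : Sph d → ℝ, Continuous f → (fun x => ∫ y, G x y * f y ∂(sphMeasure d)) ∈ Rsp d (3 * L)) := by
  refine ⟨1 + 2^(d+1), by positivity, fun L => ?_⟩
  obtain ⟨e1, K1, he1, hK1, hr1, ht1⟩ := exists_kernel d L
  obtain ⟨e2, K2, he2, hK2, hr2, ht2⟩ := exists_kernel d (2*L)
  have gen : ∀ (n : ℕ) (e : Fin (Module.finrank ℝ (Rsp d n)) → (Sph d → ℝ)) (K : Sph d → Sph d → ℝ),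
      (∀ i, e i ∈ Rsp d n) → (∀ x y, K x y = ∑ i, e i x * e i y) → 
      (∀ x y, K x y = K y x) ∧ (∀ x, K x ∈ Rsp d n) ∧ Continuous (Function.uncurry K) := by
    intro n e K h1 h2
    refine ⟨?_, ?_, ?_⟩
    · intro x y; rw [h2, h2]; simp only [mul_comm]
    · intro x
      have : K x = ∑ i, e i x • e i := by
        funext y; rw [h2]; simp
      rw [this]
      exact Submodule.sum_mem _ (fun i _ => Submodule.smul_mem _ _ (h1 i))
    · have : Function.uncurry K = fun p => ∑ i, e i p.1 * e i p.2 := by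
        funext p; exact h2 _ _
      rw [this]
      apply continuous_finset_sum
      intro i _
      exact ((Rsp_cont d (h1 i)).comp continuous_fst).mul ((Rsp_cont d (h1 i)).comp continuous_snd)
  obtain ⟨hs1, hm1, hc1⟩ := gen L e1 K1 he1 hK1
  obtain ⟨hs2, hm2, hc2⟩ := gen (2*L) e2 K2 he2 hK2
  have zon : ∀ (n : ℕ) (K : Sph d → Sph d → ℝ), (∀ x y, K x y = K y x) → (∀ x, K x ∈ Rsp d n) →
      (∀ q ∈ Rsp d n, ∀ x, ∫ y, K x y * q y ∂(sphMeasure d) = q x) →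
      ∀ x y x' y' : Sph d, ⟪(x : Esp d), (y : Esp d)⟫ = ⟪(x' : Esp d), (y' : Esp d)⟫ → K x y = K x' y' := by
    intro n K h1 h2 h3 x y x' y' h
    obtain ⟨U, rfl, rfl⟩ := exists_rot d x y x' y' h
    exact (kernel_inv d n K h1 h2 h3 U x y).symm
  have z1 := zon L K1 hs1 hm1 hr1
  have z2 := zon (2*L) K2 hs2 hm2 hr2
  let N := north d
  let V := (sphMeasure d).real Set.univ
  have diag : ∀ (K : Sph d → Sph d → ℝ), (∀ x y x' y' : Sph d, ⟪(x : Esp d), (y : Esp d)⟫ = ⟪(x' : Esp d), (y' : Esp d)⟫ → K x y = K x' y') →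
      ∀ x, K x x = K N N := by
    intro K h x
    apply h
    simp
  have d1 := diag K1 z1
  have d2 := diag K2 z2
  simp only [d1, d2, integral_const, smul_eq_mul] at ht1 ht2
  have hV : 0 ≤ V := measureReal_nonneg
  have hp := dim_pos d L
  have hp' : (0:ℝ) < Module.finrank ℝ (Rsp d L) := by exact_mod_cast hp
  have hVpos : 0 < V := by
    rcases hV.eq_or_lt with h | h
    · change V * _ = _ at ht1
      rw [← h] at ht1; simp at ht1; linarith
    · exact h
  have hb : (Module.finrank ℝ (Rsp d (2*L)) : ℝ) ≤ 2^(d+1) * Module.finrank ℝ (Rsp d L) := by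
    exact_mod_cast dim_bound d L
  rw [← ht1, ← ht2] at hb
  rw [← ht1] at hp'
  change 0 < V * _ at hp'
  change V * _ ≤ 2^(d+1) * (V * _) at hb
  have k1 : 0 < K1 N N := pos_of_mul_pos_right hp' hV
  have k2 : K2 N N ≤ 2^(d+1) * K1 N N := by
    have : V * K2 N N ≤ V * (2^(d+1) * K1 N N) := by linarith
    exact le_of_mul_le_mul_left this hVpos
  set κ := K1 N N with hκ
  have cx1 : ∀ x, Continuous (K1 x) := fun x => Rsp_cont d (hm1 x)
  have cx2 : ∀ x, Continuous (K2 x) := fun x => Rsp_cont d (hm2 x)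
  refine ⟨fun x y => κ⁻¹ * (K1 x y * K2 x y), ?_, ?_, ?_, ?_, ?_, ?_⟩
  · exact continuous_const.mul (hc1.mul hc2)
  · intro x y; simp only [hs1 x y, hs2 x y]
  · intro x y x' y' h
    simp only [z1 x y x' y' h, z2 x y x' y' h]
  · intro x
    have h1 : ∫ y, κ⁻¹ * ((K1 x y * K1 x y + K2 x y * K2 x y)/2) ∂(sphMeasure d) = κ⁻¹ * ((κ + K2 N N)/2) := by
      rw [integral_const_mul, integral_div, integral_add, hr1 _ (hm1 x), hr2 _ (hm2 x), d1, d2]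
      · exact sph_integrable d ((cx1 x).mul (cx1 x))
      · exact sph_integrable d ((cx2 x).mul (cx2 x))
    have h2 : ∫ y, |κ⁻¹ * (K1 x y * K2 x y)| ∂(sphMeasure d) ≤ 
        ∫ y, κ⁻¹ * ((K1 x y * K1 x y + K2 x y * K2 x y)/2) ∂(sphMeasure d) := by
      apply integral_mono
      · exact sph_integrable d ((continuous_const.mul ((cx1 x).mul (cx2 x))).abs)
      · exact sph_integrable d (continuous_const.mul ((((cx1 x).mul (cx1 x)).add ((cx2 x).mul (cx2 x))).div_const 2))
      · intro y
        simp only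
        rw [abs_mul, abs_of_pos (inv_pos.mpr k1)]
        apply mul_le_mul_of_nonneg_left _ (inv_pos.mpr k1).le
        rw [abs_le]
        constructor <;> nlinarith [sq_nonneg (K1 x y - K2 x y), sq_nonneg (K1 x y + K2 x y)]
    rw [h1] at h2
    refine h2.trans ?_
    rw [inv_mul_le_iff₀ k1]
    have : (0:ℝ) < 2^(d+1) := by positivity
    nlinarith
  · intro q hq x
    have h := hr2 (fun y => K1 x y * q y) (by
      have := Rsp_mul d (hm1 x) hq
      rwa [← two_mul] at this) x
    rw [d1] at h
    have h3 : ∀ y, κ⁻¹ * (K1 x y * K2 x y) * q y = κ⁻¹ * (K2 x y * (K1 x y * q y)) := by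
      intro y; ring
    simp only [h3]
    rw [integral_const_mul, h]
    field_simp
  · intro f hf
    have h : (fun x => ∫ y, κ⁻¹ * (K1 x y * K2 x y) * f y ∂(sphMeasure d)) =
        ∑ i, ∑ j, (κ⁻¹ * ∫ y, e1 i y * e2 j y * f y ∂(sphMeasure d)) • (fun x => e1 i x * e2 j x) := by
      funext x
      have h3 : ∀ y, κ⁻¹ * (K1 x y * K2 x y) * f y = 
          ∑ i, ∑ j, (κ⁻¹ * (e1 i x * e2 j x)) * (e1 i y * e2 j y * f y) := by
        intro y
        rw [hK1, hK2, Finset.sum_mul_sum, Finset.mul_sum, Finset.sum_mul]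
        apply Finset.sum_congr rfl
        intro i _
        rw [Finset.mul_sum, Finset.sum_mul]
        apply Finset.sum_congr rfl
        intro j _
        ring
      have hc : ∀ i j, Continuous (fun y => (κ⁻¹ * (e1 i x * e2 j x)) * (e1 i y * e2 j y * f y)) := by
        intro i j
        exact continuous_const.mul (((Rsp_cont d (he1 i)).mul (Rsp_cont d (he2 j))).mul hf)
      simp only [h3]
      rw [integral_finset_sum, Finset.sum_apply]
      · apply Finset.sum_congr rfl
        intro i _
        rw [integral_finset_sum, Finset.sum_apply]
        · apply Finset.sum_congr rfl
          intro j _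
          rw [integral_const_mul]
          simp only [Pi.smul_apply, smul_eq_mul]
          ring
        · intro j _
          exact sph_integrable d (hc i j)
      · intro i _
        exact sph_integrable d (continuous_finset_sum _ (fun j _ => hc i j))
    rw [h]
    apply Submodule.sum_mem
    intro i _
    apply Submodule.sum_mem
    intro j _
    apply Submodule.smul_mem
    have := Rsp_mul d (he1 i) (he2 j)
    have h3 : L + 2 * L = 3 * L := by ring
    rwa [h3] at this

lemma schur_pt {α : Type*} [MeasurableSpace α] (μ : Measure α) (g h : α → ℝ≥0∞) (r : ℝ) (hr : 1 ≤ r)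
    (hg : AEMeasurable g μ) (hh : AEMeasurable h μ) (hfin : ∀ x, g x ≠ ⊤) :
    (∫⁻ x, g x * h x ∂μ) ^ r ≤ (∫⁻ x, g x ∂μ) ^ (r - 1) * ∫⁻ x, g x * h x ^ r ∂μ := by
  have hr0 : 0 < r := by linarith
  have hri : r⁻¹ ≤ 1 := inv_le_one_of_one_le₀ hr
  have h1 := ENNReal.lintegral_mul_norm_pow_le (μ := μ) (f := g) (g := fun x => g x * h x ^ r) hg
    (hg.mul (hh.pow_const r)) (p := 1 - r⁻¹) (q := r⁻¹) (by linarith) (by positivity) (by ring)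
  have h2 : ∀ x, g x ^ (1 - r⁻¹) * (g x * h x ^ r) ^ r⁻¹ = g x * h x := by
    intro x
    rw [ENNReal.mul_rpow_of_nonneg _ _ (by positivity), ← mul_assoc,
      ← ENNReal.rpow_add_of_nonneg _ _ (by linarith) (by positivity), ← ENNReal.rpow_mul,
      mul_inv_cancel₀ hr0.ne']
    simp
  simp only [h2] at h1
  have h3 := ENNReal.rpow_le_rpow h1 hr0.le
  refine h3.trans_eq ?_
  rw [ENNReal.mul_rpow_of_nonneg _ _ hr0.le, ← ENNReal.rpow_mul, ← ENNReal.rpow_mul,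
    inv_mul_cancel₀ hr0.ne', ENNReal.rpow_one]
  congr 2
  field_simp

lemma schur_meas (d : ℕ) (G : Sph d → Sph d → ℝ) (hG : Continuous (Function.uncurry G))
    (hs : ∀ x y, G x y = G y x) (c : ℝ≥0∞) (hc : ∀ x, ∫⁻ y, ‖G x y‖ₑ ∂(sphMeasure d) ≤ c)
    (p : ℝ≥0∞) (hp : 1 ≤ p) (f : Sph d → ℝ) (hf : AEStronglyMeasurable f (sphMeasure d)) :
    eLpNorm (fun ω => ∫ x, G ω x * f x ∂(sphMeasure d)) p (sphMeasure d) ≤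
      c * eLpNorm f p (sphMeasure d) := by
  have hGx : ∀ x, Continuous (G x) := fun x => hG.comp (by fun_prop : Continuous (fun y => (x, y)))
  have hpt : ∀ ω, ‖∫ x, G ω x * f x ∂(sphMeasure d)‖ₑ ≤ ∫⁻ x, ‖G ω x‖ₑ * ‖f x‖ₑ ∂(sphMeasure d) := by
    intro ω
    refine (enorm_integral_le_lintegral_enorm _).trans_eq ?_
    simp only [enorm_mul]
  by_cases htop : p = ⊤
  · subst htop
    rw [eLpNorm_exponent_top, eLpNorm_exponent_top]
    apply eLpNormEssSup_le_of_ae_enorm_bound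
    refine Filter.Eventually.of_forall (fun ω => (hpt ω).trans ?_)
    calc ∫⁻ x, ‖G ω x‖ₑ * ‖f x‖ₑ ∂(sphMeasure d)
        ≤ ∫⁻ x, ‖G ω x‖ₑ * eLpNormEssSup f (sphMeasure d) ∂(sphMeasure d) := by
          apply lintegral_mono_ae
          filter_upwards [enorm_ae_le_eLpNormEssSup f (sphMeasure d)] with x hx
          gcongr
      _ = (∫⁻ x, ‖G ω x‖ₑ ∂(sphMeasure d)) * eLpNormEssSup f (sphMeasure d) := by
          rw [lintegral_mul_const _ (hGx ω).enorm.measurable]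
      _ ≤ _ := by gcongr; exact hc ω
  · have hp0 : p ≠ 0 := (lt_of_lt_of_le one_pos hp).ne'
    rw [eLpNorm_eq_lintegral_rpow_enorm_toReal hp0 htop, eLpNorm_eq_lintegral_rpow_enorm_toReal hp0 htop]
    set r := p.toReal with hr_def
    have hr : 1 ≤ r := by
      have := ENNReal.toReal_mono htop hp
      simpa using this
    have hr0 : 0 < r := by linarith
    have key : ∫⁻ ω, ‖∫ x, G ω x * f x ∂(sphMeasure d)‖ₑ ^ r ∂(sphMeasure d) ≤
        c ^ r * ∫⁻ x, ‖f x‖ₑ ^ r ∂(sphMeasure d) := by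
      have hm : AEMeasurable (Function.uncurry fun ω x => ‖G ω x‖ₑ * ‖f x‖ₑ ^ r)
          ((sphMeasure d).prod (sphMeasure d)) := by
        apply AEMeasurable.mul
        · exact hG.enorm.measurable.aemeasurable
        · exact (hf.comp_snd.enorm).pow_const r
      have hcr : c ^ r = c ^ (r - 1) * c := by
        conv_rhs => rw [← ENNReal.rpow_one c, ← ENNReal.rpow_mul]
        rw [← ENNReal.rpow_add_of_nonneg _ _ (by linarith) (by norm_num)]
        congr 1; ring
      calc ∫⁻ ω, ‖∫ x, G ω x * f x ∂(sphMeasure d)‖ₑ ^ r ∂(sphMeasure d)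
          ≤ ∫⁻ ω, c ^ (r-1) * ∫⁻ x, ‖G ω x‖ₑ * ‖f x‖ₑ ^ r ∂(sphMeasure d) ∂(sphMeasure d) := by
            apply lintegral_mono
            intro ω
            refine (ENNReal.rpow_le_rpow (hpt ω) hr0.le).trans ?_
            refine (schur_pt _ _ _ r hr (hGx ω).enorm.measurable.aemeasurable hf.enorm (by simp)).trans ?_
            exact mul_le_mul_left (ENNReal.rpow_le_rpow (hc ω) (by linarith)) _
        _ = c ^ (r-1) * ∫⁻ ω, ∫⁻ x, ‖G ω x‖ₑ * ‖f x‖ₑ ^ r ∂(sphMeasure d) ∂(sphMeasure d) := by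
            have hm2 : AEMeasurable (fun ω => ∫⁻ x, ‖G ω x‖ₑ * ‖f x‖ₑ ^ r ∂(sphMeasure d)) (sphMeasure d) :=
              hm.lintegral_prod_right'
            rw [lintegral_const_mul'' _ hm2]
        _ = c ^ (r-1) * ∫⁻ x, ∫⁻ ω, ‖G ω x‖ₑ * ‖f x‖ₑ ^ r ∂(sphMeasure d) ∂(sphMeasure d) := by
            rw [lintegral_lintegral_swap hm]
        _ ≤ c ^ (r-1) * ∫⁻ x, c * ‖f x‖ₑ ^ r ∂(sphMeasure d) := by
            gcongr with x
            simp only [fun ω => hs ω x]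
            rw [lintegral_mul_const _ (hGx x).enorm.measurable]
            gcongr
            exact hc x
        _ = _ := by
            rw [lintegral_const_mul'' _ (hf.enorm.pow_const r), hcr, mul_assoc]
    refine (ENNReal.rpow_le_rpow key (by positivity)).trans_eq ?_
    rw [ENNReal.mul_rpow_of_nonneg _ _ (by positivity), ← ENNReal.rpow_mul, mul_one_div_cancel hr0.ne',
      ENNReal.rpow_one]

lemma schur (d : ℕ) (G : Sph d → Sph d → ℝ) (hG : Continuous (Function.uncurry G))
    (hs : ∀ x y, G x y = G y x) (c : ℝ≥0∞) (hc : ∀ x, ∫⁻ y, ‖G x y‖ₑ ∂(sphMeasure d) ≤ c)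
    (p : ℝ≥0∞) (hp : 1 ≤ p) (f : Sph d → ℝ) :
    eLpNorm (fun ω => ∫ x, G ω x * f x ∂(sphMeasure d)) p (sphMeasure d) ≤
      c * eLpNorm f p (sphMeasure d) := by
  have hGx : ∀ x, Continuous (G x) := fun x => hG.comp (by fun_prop : Continuous (fun y => (x, y)))
  let A : Set (Sph d) := {ω | AEStronglyMeasurable (fun x => G ω x * f x) (sphMeasure d)}
  let O : A → Set (Sph d) := fun ω => {x | G ω x ≠ 0}
  have hO : ∀ ω, IsOpen (O ω) := fun ω => isOpen_ne_fun (hGx ω) continuous_const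
  obtain ⟨T, hTc, hT⟩ := TopologicalSpace.isOpen_iUnion_countable O hO
  have hUm : MeasurableSet (⋃ ω, O ω) := (isOpen_iUnion hO).measurableSet
  have hfO : ∀ ω : A, AEStronglyMeasurable f ((sphMeasure d).restrict (O ω)) := by
    intro ω
    have h1 : AEStronglyMeasurable (fun x => (G ω x)⁻¹ * (G ω x * f x)) ((sphMeasure d).restrict (O ω)) := by
      apply AEStronglyMeasurable.mul
      · exact ((hGx ω).measurable.inv).aestronglyMeasurable
      · exact AEStronglyMeasurable.restrict ω.2
    refine h1.congr ?_
    filter_upwards [ae_restrict_mem (hO ω).measurableSet] with x hx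
    have hx' : G ω x ≠ 0 := hx
    field_simp
  have hfU : AEStronglyMeasurable ((⋃ ω, O ω).indicator f) (sphMeasure d) := by
    rw [aestronglyMeasurable_indicator_iff hUm, ← hT]
    have := hTc.to_subtype
    rw [Set.biUnion_eq_iUnion, aestronglyMeasurable_iUnion_iff]
    intro i
    exact hfO i
  have h1 := schur_meas d G hG hs c hc p hp _ hfU
  refine (eLpNorm_mono ?_).trans (h1.trans ?_)
  · intro ω
    by_cases hω : ω ∈ A
    · apply le_of_eq
      congr 2
      funext x
      by_cases hx : G ω x = 0
      · simp [hx]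
      · rw [Set.indicator_of_mem (Set.mem_iUnion.mpr ⟨⟨ω, hω⟩, hx⟩)]
    · rw [integral_non_aestronglyMeasurable hω]
      simp
  · gcongr
    apply eLpNorm_mono
    intro x
    exact norm_indicator_le_norm_self f x

theorem stmt7 (d : ℕ) (hd : 1 ≤ d) :
    ∃ C : ℝ, 0 < C ∧ ∀ L : ℕ,
      ∃ gflat : ℝ → ℝ,
        (∫ ω, |gflat ⟪(ω : Esp d), (north d : Esp d)⟫| ∂(sphMeasure d)) ≤ C ∧
        (∀ p : ℝ≥0∞, 1 ≤ p → ∀ f : Sph d → ℝ,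
          eLpNorm (fun ω : Sph d =>
              ∫ x, gflat ⟪(ω : Esp d), (x : Esp d)⟫ * f x ∂(sphMeasure d)) p (sphMeasure d)
            ≤ ENNReal.ofReal C * eLpNorm f p (sphMeasure d)) ∧
        (∀ Q ∈ PiSp d L,
          (fun ω : Sph d =>
            ∫ x, gflat ⟪(ω : Esp d), (x : Esp d)⟫ * Q x ∂(sphMeasure d)) = Q) ∧
        (∀ M : ℕ, ∀ f ∈ PiSp d M,
          (fun ω : Sph d =>
            ∫ x, gflat ⟪(ω : Esp d), (x : Esp d)⟫ * f x ∂(sphMeasure d)) ∈ PiSp d (3 * L)) := by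
  obtain ⟨C, hC, h⟩ := exists_G d
  refine ⟨C, hC, fun L => ?_⟩
  obtain ⟨G, hG, hs, hz, hb, hr, hm⟩ := h L
  classical
  let gflat : ℝ → ℝ := fun t =>
    if h : ∃ q : Sph d × Sph d, ⟪(q.1 : Esp d), (q.2 : Esp d)⟫ = t then G h.choose.1 h.choose.2 else 0
  have hg : ∀ x y : Sph d, gflat ⟪(x : Esp d), (y : Esp d)⟫ = G x y := by
    intro x y
    have hex : ∃ q : Sph d × Sph d, ⟪(q.1 : Esp d), (q.2 : Esp d)⟫ = ⟪(x : Esp d), (y : Esp d)⟫ :=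
      ⟨(x, y), rfl⟩
    simp only [gflat]
    rw [dif_pos hex]
    exact hz _ _ _ _ hex.choose_spec
  have hGx : ∀ x, Continuous (G x) := fun x => hG.comp (by fun_prop : Continuous (fun y => (x, y)))
  refine ⟨gflat, ?_, ?_, ?_, ?_⟩
  · simp only [hg, fun ω => hs ω (north d)]
    exact hb _
  · intro p hp f
    simp only [hg]
    apply schur d G hG hs _ _ p hp
    intro x
    rw [← ofReal_integral_norm_eq_lintegral_enorm (sph_integrable d (hGx x))]
    exact ENNReal.ofReal_le_ofReal (hb x)
  · intro Q hQ
    rw [PiSp_eq] at hQ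
    simp only [hg]
    funext ω
    exact hr Q hQ ω
  · intro M f hf
    rw [PiSp_eq] at hf ⊢
    simp only [hg]
    exact hm f (Rsp_cont d hf)

end
end

section
/- There exist constants c, C > 0 depending only on d, p, ρ such that for all L ≥ 1 and all Q ∈ Π_L (extended harmonically to R^{d+1}): c·‖Q‖^p_{L^p(S^d)} ≤ L·∫_{C_{ρ,L}} |Q(x)|^p dm(x) ≤ C·‖Q‖^p_{L^p(S^d)}, where C_{ρ,L} = {x ∈ R^{d+1} : | |x| − 1 | < ρ/L} and m is Lebesgue measure on R^{d+1}. -/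
open MeasureTheory MvPolynomial
open scoped RealInnerProductSpace ENNReal

noncomputable section

abbrev VP (d : ℕ) := MvPolynomial (Fin (d+1)) ℝ

/-- infinitesimal rotation -/
def Dij (d : ℕ) (i j : Fin (d+1)) : Derivation ℝ (VP d) (VP d) :=
  (X j : VP d) • pderiv i - (X i : VP d) • pderiv j

def bk (d : ℕ) (i j k : Fin (d+1)) : VP d := (if k = i then X j else 0) - (if k = j then X i else 0)

def ak (d : ℕ) (i j k : Fin (d+1)) : VP d := (if k = i then X i else 0) + (if k = j then X j else 0)

def rot (d : ℕ) (i j : Fin (d+1)) (c s : ℝ) : VP d →ₐ[ℝ] VP d :=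
  aeval (fun k => X k + C (c - 1) * ak d i j k + C s * bk d i j k)

lemma Dij_X (d : ℕ) (i j k : Fin (d+1)) : Dij d i j (X k) = bk d i j k := by
  simp only [Dij, bk, Derivation.sub_apply, Derivation.smul_apply, pderiv_X, smul_eq_mul,
    Pi.single_apply]
  split_ifs <;> simp_all

lemma Dij_bk (d : ℕ) (i j k : Fin (d+1)) (h : i ≠ j) : Dij d i j (bk d i j k) = - ak d i j k := by
  have h' := h.symm
  unfold bk ak
  by_cases h1 : k = i
  · subst h1
    simp [h, Dij_X, bk, h']
  · by_cases h2 : k = j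
    · subst h2
      simp [h, Dij_X, bk, h']
    · simp [h1, h2]

structure TRep (d : ℕ) (i j : Fin (d+1)) (m : ℕ) (P : VP d) : Prop where
  ex : ∃ W U : Polynomial (VP d), W.degree < ((m + 1 : ℕ) : WithBot ℕ) ∧ U.degree < (m : WithBot ℕ) ∧
    W.eval 1 = P ∧ U.eval 1 = Dij d i j P ∧ W.derivative.eval 1 = - Dij d i j (Dij d i j P) ∧
    ∀ c s : ℝ, c ^ 2 + s ^ 2 = 1 → rot d i j c s P = W.eval (C c) + C s * U.eval (C c)

lemma deg_step {R : Type*} [CommRing R] {W : Polynomial R} {m : ℕ} (h : W.degree < (m : WithBot ℕ))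
    (Q : Polynomial R) (hQ : Q.natDegree ≤ 1) : (W * Q).degree < ((m + 1 : ℕ) : WithBot ℕ) := by
  by_cases hW : W = 0
  · subst hW; simp
  rw [← Polynomial.natDegree_lt_iff_degree_lt hW] at h
  refine lt_of_le_of_lt Polynomial.degree_le_natDegree ?_
  have := Polynomial.natDegree_mul_le (p := W) (q := Q)
  exact_mod_cast (by omega)

lemma TRep.mono {d : ℕ} {i j : Fin (d+1)} {m m' : ℕ} {P : VP d} (h : TRep d i j m P) (hm : m ≤ m') :
    TRep d i j m' P := by
  obtain ⟨W, U, h1, h2, h3⟩ := h.ex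
  exact ⟨W, U, h1.trans_le (by exact_mod_cast Nat.succ_le_succ hm), h2.trans_le (by exact_mod_cast hm), h3⟩

lemma TRep.C' (d : ℕ) (i j : Fin (d+1)) (m : ℕ) (a : ℝ) : TRep d i j m (C a) := by
  refine ⟨Polynomial.C (C a), 0, ?_, ?_, ?_, ?_, ?_, ?_⟩
  · refine lt_of_le_of_lt Polynomial.degree_C_le ?_
    exact_mod_cast Nat.succ_pos m
  · simp
  · simp
  · simp [← algebraMap_eq]
  · simp [← algebraMap_eq]
  · intro c s _
    simp [rot]

lemma TRep.add {d : ℕ} {i j : Fin (d+1)} {m : ℕ} {P Q : VP d} (h : TRep d i j m P)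
    (h' : TRep d i j m Q) : TRep d i j m (P + Q) := by
  obtain ⟨W, U, h1, h2, h3, h4, h5, h6⟩ := h.ex
  obtain ⟨W', U', h1', h2', h3', h4', h5', h6'⟩ := h'.ex
  refine ⟨W + W', U + U', ?_, ?_, ?_, ?_, ?_, ?_⟩
  · exact (Polynomial.degree_add_le _ _).trans_lt (max_lt h1 h1')
  · exact (Polynomial.degree_add_le _ _).trans_lt (max_lt h2 h2')
  · simp [h3, h3']
  · simp [h4, h4']
  · simp [h5, h5']; ring
  · intro c s hcs
    rw [map_add, h6 c s hcs, h6' c s hcs]; simp; ring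

lemma TRep.mul_X {d : ℕ} {i j : Fin (d+1)} (hij : i ≠ j) {m : ℕ} {P : VP d} (h : TRep d i j m P)
    (k : Fin (d+1)) : TRep d i j (m+1) (P * X k) := by
  obtain ⟨W, U, h1, h2, h3, h4, h5, h6⟩ := h.ex
  have hD := Dij_X d i j k
  have hDD := Dij_bk d i j k hij
  set a := ak d i j k with ha
  set b := bk d i j k with hb
  have hlin : ((Polynomial.X - 1) * Polynomial.C a + Polynomial.C (X k) :
      Polynomial (VP d)).natDegree ≤ 1 := by
    compute_degree
  refine ⟨W * ((Polynomial.X - 1) * Polynomial.C a + Polynomial.C (X k))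
      + (U * (1 - Polynomial.X)) * ((1 + Polynomial.X) * Polynomial.C b),
    U * ((Polynomial.X - 1) * Polynomial.C a + Polynomial.C (X k)) + W * Polynomial.C b,
    ?_, ?_, ?_, ?_, ?_, ?_⟩
  · refine (Polynomial.degree_add_le _ _).trans_lt (max_lt (deg_step h1 _ hlin) ?_)
    refine deg_step (deg_step h2 _ ?_) _ ?_ <;> compute_degree
  · refine (Polynomial.degree_add_le _ _).trans_lt (max_lt (deg_step h2 _ hlin) ?_)
    refine lt_of_le_of_lt ?_ h1
    rw [mul_comm]
    rw [← Polynomial.smul_eq_C_mul]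
    exact Polynomial.degree_smul_le _ _
  · simp [h3]
  · simp [h3, h4, hD]; ring
  · simp [h3, h4, h5, hD, hDD]; ring
  · intro c s hcs
    have hs : (C s : VP d) ^ 2 = 1 - (C c) ^ 2 := by
      rw [← map_pow, ← map_pow, ← map_one C, ← map_sub]; congr 1; linarith
    have : rot d i j c s (X k) = X k + C (c - 1) * a + C s * b := by simp [rot, ha, hb]
    rw [map_mul, h6 c s hcs, this]
    simp only [Polynomial.eval_add, Polynomial.eval_mul, Polynomial.eval_sub, Polynomial.eval_X,
      Polynomial.eval_one, Polynomial.eval_C, map_sub, map_one]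
    linear_combination (Polynomial.eval (C c) U * b) * hs

lemma TRep.of_deg {d : ℕ} {i j : Fin (d+1)} (hij : i ≠ j) {m : ℕ} {P : VP d}
    (h : P.totalDegree ≤ m) : TRep d i j m P := by
  have hmon : ∀ (s : Fin (d+1) →₀ ℕ) (a : ℝ), ∀ m, (monomial s a).totalDegree ≤ m →
      TRep d i j m (monomial s a) := by
    refine MvPolynomial.induction_on_monomial
      (motive := fun Q => ∀ m, Q.totalDegree ≤ m → TRep d i j m Q) ?_ ?_
    · intro a m _; exact TRep.C' d i j m a
    · intro p k hp m hm
      by_cases hp0 : p = 0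
      · subst hp0
        simpa using TRep.C' d i j m 0
      · rw [totalDegree_mul_of_isDomain hp0 (X_ne_zero k), totalDegree_X] at hm
        obtain ⟨m', rfl⟩ : ∃ m', m = m' + 1 := ⟨m - 1, by omega⟩
        exact TRep.mul_X hij (hp m' (by omega)) k
  rw [P.as_sum]
  have : ∀ S ⊆ P.support, TRep d i j m (∑ v ∈ S, monomial v (coeff v P)) := by
    intro S
    induction S using Finset.induction_on with
    | empty => intro _; simpa using TRep.C' d i j m 0
    | insert v S hv ih =>
      intro hS
      rw [Finset.sum_insert hv]
      refine TRep.add (hmon _ _ _ ?_) (ih fun x hx => hS (Finset.mem_insert_of_mem hx))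
      refine le_trans ?_ h
      refine (totalDegree_monomial_le _ _).trans ?_
      exact le_totalDegree (hS (Finset.mem_insert_self _ _))
  exact this _ subset_rfl

lemma key_poly {d : ℕ} {i j : Fin (d+1)} (hij : i ≠ j) {m : ℕ} {P : VP d}
    (h : P.totalDegree ≤ m) (g : VP d →ₗ[ℝ] ℝ) :
    ∃ p : Polynomial ℝ, p.degree ≤ m ∧ p.eval 1 = g P ∧
      p.derivative.eval 1 = - g (Dij d i j (Dij d i j P)) ∧
      ∀ c s : ℝ, c ^ 2 + s ^ 2 = 1 →
        2 * p.eval c = g (rot d i j c s P) + g (rot d i j c (-s) P) := by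
  obtain ⟨W, U, h1, h2, h3, h4, h5, h6⟩ := (TRep.of_deg hij h).ex
  have hgC : ∀ (r : ℝ) (Q : VP d), g (Q * C r) = g Q * r := by
    intro r Q
    rw [mul_comm, ← smul_eq_C_mul, map_smul, smul_eq_mul, mul_comm]
  have hWn : W.natDegree < m + 1 := by
    by_cases hW : W = 0
    · simp [hW]
    · rwa [← Polynomial.natDegree_lt_iff_degree_lt hW] at h1
  obtain ⟨p, hpd, hpc⟩ : ∃ p : Polynomial ℝ, p.natDegree ≤ m ∧ ∀ k, p.coeff k = g (W.coeff k) := by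
    refine ⟨∑ k ∈ Finset.range (m+1), Polynomial.monomial k (g (W.coeff k)), ?_, ?_⟩
    · refine Polynomial.natDegree_sum_le_of_forall_le _ _ fun k hk => ?_
      refine (Polynomial.natDegree_monomial_le _).trans ?_
      have := Finset.mem_range.1 hk
      omega
    · intro k
      simp only [Polynomial.finset_sum_coeff, Polynomial.coeff_monomial]
      rw [Finset.sum_ite_eq']
      split_ifs with hk
      · rfl
      · rw [Polynomial.coeff_eq_zero_of_natDegree_lt, map_zero]
        simp at hk
        omega
  have hev : ∀ c, p.eval c = g (W.eval (C c)) := by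
    intro c
    rw [Polynomial.eval_eq_sum_range' hWn, map_sum,
      Polynomial.eval_eq_sum_range' (Nat.lt_succ_of_le hpd)]
    refine Finset.sum_congr rfl fun k _ => ?_
    rw [← map_pow, hgC, hpc]
  refine ⟨p, Polynomial.natDegree_le_iff_degree_le.1 hpd, ?_, ?_, ?_⟩
  · rw [hev]; simp [h3]
  · rw [← map_neg, ← h5]
    have e1 : W.derivative.natDegree < m + 1 :=
      (Polynomial.natDegree_derivative_le _).trans_lt (by omega)
    have e2 : p.derivative.natDegree < m + 1 :=
      (Polynomial.natDegree_derivative_le _).trans_lt (by omega)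
    rw [Polynomial.eval_eq_sum_range' e1, map_sum, Polynomial.eval_eq_sum_range' e2]
    refine Finset.sum_congr rfl fun k _ => ?_
    have hc : ((k : VP d) + 1) = C ((k : ℝ) + 1) := by simp
    simp only [Polynomial.coeff_derivative, one_pow, mul_one]
    rw [hpc, hc, hgC]
  · intro c s hcs
    rw [h6 c s hcs, h6 c (-s) (by linarith [neg_sq s]), hev]
    simp only [map_add, map_neg, neg_mul]
    ring

lemma sum_Dij_sq {d ℓ : ℕ} {P : VP d} (hP : P ∈ harmHomog d ℓ) :
    ∑ i, ∑ j, Dij d i j (Dij d i j P) = (-(2 * ((ℓ : ℝ) * (ℓ + d - 1)))) • P := by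
  obtain ⟨h1, h2⟩ := hP
  have h1' : P.IsHomogeneous ℓ := by simpa using h1
  have hE := h1'.sum_X_mul_pderiv
  have hL : ∑ i, pderiv i (pderiv i P) = 0 := by
    have : polyLap d P = 0 := h2
    simpa [polyLap, LinearMap.sum_apply] using this
  have hEE : ∑ i, ∑ j, X i * (X j * pderiv i (pderiv j P)) = (ℓ : VP d) * ℓ * P - ℓ * P := by
    have : ∀ i, ∑ j, X i * (X j * pderiv i (pderiv j P)) = X i * pderiv i (ℓ • P) - X i * pderiv i P := by
      intro i
      rw [← hE, map_sum, Finset.mul_sum]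
      simp only [Derivation.leibniz, pderiv_X, smul_eq_mul, mul_add, Finset.sum_add_distrib,
        Pi.single_apply]
      simp
    simp only [this, Finset.sum_sub_distrib, hE, map_nsmul, mul_smul_comm, ← Finset.smul_sum]
    simp only [nsmul_eq_mul]; ring
  have key : ∀ i j, Dij d i j (Dij d i j P) =
      (if i = j then (X i * pderiv i P + X j * pderiv j P) else 0)
      + X j * X j * pderiv i (pderiv i P) + X i * X i * pderiv j (pderiv j P)
      - X i * pderiv i P - X j * pderiv j P
      - X i * (X j * pderiv i (pderiv j P)) - X j * (X i * pderiv j (pderiv i P)) := by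
    intro i j
    simp only [Dij, Derivation.sub_apply, Derivation.smul_apply, smul_eq_mul, map_sub,
      Derivation.leibniz, pderiv_X, Pi.single_apply]
    by_cases h : i = j
    · subst h; simp; ring
    · have h' : ¬ j = i := fun e => h e.symm
      simp [h, h']; ring
  simp only [key, Finset.sum_add_distrib, Finset.sum_sub_distrib]
  have e1 : ∑ i, ∑ j, (if i = j then (X i * pderiv i P + X j * pderiv j P) else 0) = 2 * (ℓ * P) := by
    simp [Finset.sum_add_distrib, hE]; ring
  have e2 : ∑ i, ∑ j, X j * X j * pderiv i (pderiv i P) = 0 := by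
    rw [Finset.sum_comm]
    simp [← Finset.mul_sum, hL]
  have e3 : ∑ i, ∑ j, X i * X i * pderiv j (pderiv j P) = 0 := by
    simp [← Finset.mul_sum, hL]
  have e4 : ∑ i, ∑ _j : Fin (d+1), X i * pderiv i P = ((d : VP d) + 1) * (ℓ * P) := by
    rw [Finset.sum_comm]
    simp [hE]
  have e5 : ∑ _i : Fin (d+1), ∑ j, X j * pderiv j P = ((d : VP d) + 1) * (ℓ * P) := by
    simp [hE]
  have e6 : ∑ i, ∑ j, X j * (X i * pderiv j (pderiv i P)) = (ℓ : VP d) * ℓ * P - ℓ * P := by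
    rw [Finset.sum_comm]; exact hEE
  rw [e1, e2, e3, e4, e5, e6, hEE, smul_eq_C_mul]
  have c2 : (C (2:ℝ) : VP d) = 2 := map_ofNat C 2
  simp [c2]
  ring

section abstr
variable {d : ℕ} {E : Type*} [NormedAddCommGroup E] [NormedSpace ℝ E] (J : VP d →ₗ[ℝ] E)

lemma accr1 (hJ : ∀ i j, i ≠ j → ∀ c s : ℝ, c ^ 2 + s ^ 2 = 1 → ∀ P, ‖J (rot d i j c s P)‖ = ‖J P‖)
    (g : VP d →ₗ[ℝ] ℝ) (hg : ∀ Q, |g Q| ≤ ‖J Q‖) (P : VP d) (hP : g P = ‖J P‖) (i j : Fin (d+1)) :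
    g (Dij d i j (Dij d i j P)) ≤ 0 := by
  by_cases hij : i = j
  · subst hij; simp [Dij]
  obtain ⟨p, -, h1, h2, h3⟩ := key_poly hij (le_refl P.totalDegree) g
  by_contra! hcon
  have hneg : p.derivative.eval 1 < 0 := by rw [h2]; linarith
  have hle : ∀ c ∈ Set.Icc (-1 : ℝ) 1, p.eval c ≤ p.eval 1 := by
    intro c hc
    have hs : c ^ 2 + (√(1 - c ^ 2)) ^ 2 = 1 := by
      rw [Real.sq_sqrt] <;> nlinarith [hc.1, hc.2]
    have := h3 c _ hs
    have e1 := (le_abs_self _).trans (hg (rot d i j c (√(1 - c ^ 2)) P))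
    have e2 := (le_abs_self _).trans (hg (rot d i j c (-√(1 - c ^ 2)) P))
    rw [hJ i j hij _ _ hs] at e1
    rw [hJ i j hij _ _ (by rw [neg_sq]; exact hs)] at e2
    rw [h1, hP]; linarith
  have hd := (p.hasDerivAt 1)
  have := hd.tendsto_slope
  have h4 : ∀ᶠ x in nhdsWithin (1:ℝ) {1}ᶜ, slope (fun x => p.eval x) 1 x < 0 :=
    this.eventually (gt_mem_nhds hneg)
  have h5 : ∀ᶠ x in nhdsWithin (1:ℝ) (Set.Iio 1), slope (fun x => p.eval x) 1 x < 0 :=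
    h4.filter_mono (nhdsWithin_mono _ (by intro x hx; exact ne_of_lt hx))
  have h6 : ∀ᶠ x in nhdsWithin (1:ℝ) (Set.Iio 1), x ∈ Set.Ioo (-1:ℝ) 1 :=
    Ioo_mem_nhdsLT (by norm_num)
  obtain ⟨x, hx1, hx2⟩ := (h5.and h6).exists
  have := hle x ⟨hx2.1.le, hx2.2.le⟩
  rw [slope_def_field] at hx1
  have : 0 ≤ (p.eval x - p.eval 1) / (x - 1) :=
    div_nonneg_of_nonpos (by linarith) (by linarith [hx2.2])
  linarith

lemma markov_one {p : Polynomial ℝ} {m : ℕ} {M : ℝ} (hM : 0 ≤ M) (hp : p.degree ≤ m)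
    (h : ∀ x ∈ Set.Icc (-1 : ℝ) 1, |p.eval x| ≤ M) : p.derivative.eval 1 ≤ m ^ 2 * M := by
  have aux : ∀ M' > 0, M ≤ M' → p.derivative.eval 1 ≤ m ^ 2 * M' := by
    intro M' hM' hMM
    have := Polynomial.Chebyshev.eval_iterate_derivative_le_of_forall_abs_le_one (n := m)
      (P := Polynomial.C (M'⁻¹) * p) (k := 1) (x := 1) le_rfl
      (by rw [← Polynomial.smul_eq_C_mul]; exact (Polynomial.degree_smul_le _ _).trans hp) (by
        intro x hx
        rw [Polynomial.eval_mul, Polynomial.eval_C, abs_mul, abs_of_pos (inv_pos.2 hM'),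
          inv_mul_le_iff₀ hM', mul_one]
        exact (h x hx).trans hMM)
    simp only [Function.iterate_one, Polynomial.derivative_C_mul, Polynomial.eval_mul,
      Polynomial.eval_C, Polynomial.Chebyshev.derivative_T_eval_one] at this
    rw [inv_mul_le_iff₀ hM'] at this
    push_cast at this
    linarith
  rcases hM.eq_or_lt with h0 | h0
  · subst h0
    refine le_of_forall_pos_le_add fun ε hε => ?_
    have := aux (ε / (m ^ 2 + 1)) (by positivity) (by positivity)
    refine this.trans ?_
    rw [mul_zero, zero_add, mul_div_assoc', div_le_iff₀ (by positivity)]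
    nlinarith
  · exact aux M h0 le_rfl

lemma bern1 (hJ : ∀ i j, i ≠ j → ∀ c s : ℝ, c ^ 2 + s ^ 2 = 1 → ∀ P, ‖J (rot d i j c s P)‖ = ‖J P‖)
    (P : VP d) (L : ℕ) (hP : P.totalDegree ≤ L) (i j : Fin (d+1)) :
    ‖J (Dij d i j (Dij d i j P))‖ ≤ L ^ 2 * ‖J P‖ := by
  by_cases hij : i = j
  · subst hij; simp [Dij]; positivity
  obtain ⟨g, hg1, hg2⟩ := exists_dual_vector'' ℝ (J (Dij d i j (Dij d i j P)))
  let g' : VP d →ₗ[ℝ] ℝ := -(g.toLinearMap ∘ₗ J)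
  have hg' : ∀ Q, |g' Q| ≤ ‖J Q‖ := by
    intro Q
    have := g.le_of_opNorm_le hg1 (J Q)
    simpa [g'] using this
  obtain ⟨p, h0, h1, h2, h3⟩ := key_poly hij hP g'
  have := markov_one (norm_nonneg (J P)) h0 (by
    intro c hc
    have hs : c ^ 2 + (√(1 - c ^ 2)) ^ 2 = 1 := by
      rw [Real.sq_sqrt] <;> nlinarith [hc.1, hc.2]
    have := h3 c _ hs
    have e1 := (hg' (rot d i j c (√(1 - c ^ 2)) P))
    have e2 := (hg' (rot d i j c (-√(1 - c ^ 2)) P))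
    rw [hJ i j hij _ _ hs] at e1
    rw [hJ i j hij _ _ (by rw [neg_sq]; exact hs)] at e2
    rw [abs_le] at *
    constructor <;> linarith)
  rw [h2] at this
  have e : g' (Dij d i j (Dij d i j P)) = - ‖J (Dij d i j (Dij d i j P))‖ := by
    simp only [g', LinearMap.neg_apply, LinearMap.comp_apply]
    exact congrArg Neg.neg hg2
  rw [e] at this
  linarith

lemma sum_harm (L : ℕ) (Pf : ℕ → VP d) (hPf : ∀ ℓ, Pf ℓ ∈ harmHomog d ℓ) :
    ∑ ℓ ∈ Finset.range (L+1), ((ℓ : ℝ) * (ℓ + d - 1)) • Pf ℓ =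
      (-(1/2 : ℝ)) • ∑ i, ∑ j, Dij d i j (Dij d i j (∑ ℓ ∈ Finset.range (L+1), Pf ℓ)) := by
  have : ∑ i, ∑ j, Dij d i j (Dij d i j (∑ ℓ ∈ Finset.range (L+1), Pf ℓ)) =
      ∑ ℓ ∈ Finset.range (L+1), ∑ i, ∑ j, Dij d i j (Dij d i j (Pf ℓ)) := by
    simp only [map_sum]
    rw [Finset.sum_comm (s := Finset.range (L+1))]
    refine Finset.sum_congr rfl fun i _ => ?_
    rw [Finset.sum_comm]
  rw [this, Finset.smul_sum]
  refine Finset.sum_congr rfl fun ℓ _ => ?_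
  rw [sum_Dij_sq (hPf ℓ), smul_smul]
  congr 1; ring

lemma deg_harm (L : ℕ) (Pf : ℕ → VP d) (hPf : ∀ ℓ, Pf ℓ ∈ harmHomog d ℓ) :
    (∑ ℓ ∈ Finset.range (L+1), Pf ℓ).totalDegree ≤ L := by
  refine totalDegree_finsetSum_le fun ℓ hℓ => ?_
  have : (Pf ℓ).IsHomogeneous ℓ := by simpa using (hPf ℓ).1
  have := Finset.mem_range.1 hℓ
  have := (‹(Pf ℓ).IsHomogeneous ℓ›).totalDegree_le
  omega

lemma accr2 (hJ : ∀ i j, i ≠ j → ∀ c s : ℝ, c ^ 2 + s ^ 2 = 1 → ∀ P, ‖J (rot d i j c s P)‖ = ‖J P‖)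
    (L : ℕ) (Pf : ℕ → VP d) (hPf : ∀ ℓ, Pf ℓ ∈ harmHomog d ℓ)
    (g : VP d →ₗ[ℝ] ℝ) (hg : ∀ Q, |g Q| ≤ ‖J Q‖)
    (hP : g (∑ ℓ ∈ Finset.range (L+1), Pf ℓ) = ‖J (∑ ℓ ∈ Finset.range (L+1), Pf ℓ)‖) :
    0 ≤ ∑ ℓ ∈ Finset.range (L+1), ((ℓ : ℝ) * (ℓ + d - 1)) * g (Pf ℓ) := by
  have h := congrArg g (sum_harm L Pf hPf)
  simp only [map_sum g, map_smul, smul_eq_mul] at h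
  rw [h]
  have : ∑ i, ∑ j, g (Dij d i j (Dij d i j (∑ ℓ ∈ Finset.range (L+1), Pf ℓ))) ≤ 0 :=
    Finset.sum_nonpos fun i _ => Finset.sum_nonpos fun j _ => accr1 J hJ g hg _ hP i j
  linarith

lemma bern2 (hJ : ∀ i j, i ≠ j → ∀ c s : ℝ, c ^ 2 + s ^ 2 = 1 → ∀ P, ‖J (rot d i j c s P)‖ = ‖J P‖)
    (L : ℕ) (Pf : ℕ → VP d) (hPf : ∀ ℓ, Pf ℓ ∈ harmHomog d ℓ) :
    ‖J (∑ ℓ ∈ Finset.range (L+1), ((ℓ : ℝ) * (ℓ + d - 1)) • Pf ℓ)‖ ≤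
      (d + 1) ^ 2 * L ^ 2 * ‖J (∑ ℓ ∈ Finset.range (L+1), Pf ℓ)‖ := by
  rw [sum_harm L Pf hPf, map_smul, norm_smul, map_sum]
  set P := ∑ ℓ ∈ Finset.range (L+1), Pf ℓ
  have : ‖∑ i, J (∑ j, Dij d i j (Dij d i j P))‖ ≤ ∑ _i : Fin (d+1), ∑ _j : Fin (d+1), (L ^ 2 * ‖J P‖) := by
    refine norm_sum_le_of_le _ fun i _ => ?_
    rw [map_sum]
    refine norm_sum_le_of_le _ fun j _ => ?_
    exact bern1 J hJ P L (deg_harm L Pf hPf) i j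
  simp only [Finset.sum_const, Finset.card_univ, Fintype.card_fin, nsmul_eq_mul] at this
  push_cast at this
  have h0 := norm_nonneg (∑ i, J (∑ j, Dij d i j (Dij d i j P)))
  rw [show ‖(-(1/2) : ℝ)‖ = 1/2 by norm_num]
  linarith
end abstr
lemma aux_alg (a b f M : ℝ) : a / f * (b * M) = (b * a) / f * M := by ring


section abstr2
variable {d : ℕ} {E : Type*} [NormedAddCommGroup E] [NormedSpace ℝ E] (J : VP d →ₗ[ℝ] E)

def uu (L : ℕ) (Pf : ℕ → VP d) (s : ℝ) : VP d := ∑ ℓ ∈ Finset.range (L+1), Real.exp (ℓ * s) • Pf ℓ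

lemma no_max {f f' : ℝ → ℝ} {f'' x : ℝ} (h1 : ∀ y, HasDerivAt f (f' y) y)
    (h2 : HasDerivAt f' f'' x) (h0 : f' x = 0) (hpos : 0 < f'') (hmax : IsLocalMax f x) : False := by
  have hd : deriv f = f' := funext fun y => (h1 y).deriv
  have hmin : IsLocalMin f x := by
    apply isLocalMin_of_deriv_deriv_pos
    · rw [hd, h2.deriv]; exact hpos
    · rw [hd, h0]
    · exact (h1 x).continuousAt
  have hc : f =ᶠ[nhds x] fun _ => f x := by
    filter_upwards [hmin, hmax] with y a b
    exact le_antisymm b a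
  have h3 : deriv f =ᶠ[nhds x] deriv (fun _ => f x) := hc.deriv
  have h4 : deriv (deriv f) x = deriv (deriv fun _ => f x) x := h3.deriv_eq
  rw [hd, h2.deriv] at h4
  simp at h4
  linarith

lemma mono_uu (hd : 1 ≤ d)
    (hJ : ∀ i j, i ≠ j → ∀ c s : ℝ, c ^ 2 + s ^ 2 = 1 → ∀ P, ‖J (rot d i j c s P)‖ = ‖J P‖)
    (L : ℕ) (Pf : ℕ → VP d) (hPf : ∀ ℓ, Pf ℓ ∈ harmHomog d ℓ) {a b : ℝ} (hab : a ≤ b) :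
    ‖J (uu L Pf a)‖ ≤ ‖J (uu L Pf b)‖ := by
  have hd' : (0:ℝ) ≤ d - 1 := by
    have : (1:ℝ) ≤ d := by exact_mod_cast hd
    linarith
  set φ : ℝ → ℝ := fun s => ‖J (uu L Pf s)‖ with hφ
  have hφc : Continuous φ := by
    simp only [hφ, uu, map_sum, map_smul]
    fun_prop
  set K := ∑ ℓ ∈ Finset.range (L+1), Real.exp (ℓ * b) * ‖J (Pf ℓ)‖
  have hK : ∀ s ≤ b, φ s ≤ K := by
    intro s hs
    simp only [hφ, uu, map_sum, map_smul]
    refine norm_sum_le_of_le _ fun ℓ _ => ?_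
    rw [norm_smul, Real.norm_eq_abs, abs_of_pos (Real.exp_pos _)]
    gcongr
  let G : ℝ → ℝ := fun s => s + Real.exp s
  have main : ∀ η > 0, φ a + η * G a ≤ φ b + η * G b := by
    intro η hη
    by_contra! hcon
    obtain ⟨s0, hs0a, hs0⟩ : ∃ s0 < a, K + η * (s0 + Real.exp a) < φ a + η * G a := by
      refine ⟨min (a - 1) ((φ a + η * G a - K - η * Real.exp a - 1) / η), ?_, ?_⟩
      · exact (min_le_left _ _).trans_lt (by linarith)
      · have := min_le_right (a - 1) ((φ a + η * G a - K - η * Real.exp a - 1) / η)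
        rw [le_div_iff₀ hη] at this
        nlinarith
    have hcont : ContinuousOn (fun s => φ s + η * G s) (Set.Icc s0 b) := by
      apply Continuous.continuousOn
      simp only [G]
      fun_prop
    obtain ⟨x, hx, hxmax⟩ := isCompact_Icc.exists_isMaxOn
      (Set.nonempty_Icc.2 (hs0a.le.trans hab)) hcont
    have hxa : φ a + η * G a ≤ φ x + η * G x := hxmax ⟨hs0a.le, hab⟩
    have hxb : x ≠ b := by rintro rfl; linarith
    have hx0 : x ≠ s0 := by
      rintro rfl
      have h1 := hK x hx.2
      have h2 : η * G x ≤ η * (x + Real.exp a) := by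
        simp only [G]; gcongr
      linarith
    have hlt : x < b := lt_of_le_of_ne hx.2 hxb
    have hgt : s0 < x := lt_of_le_of_ne hx.1 (Ne.symm hx0)
    obtain ⟨g0, hg1, hg2⟩ := exists_dual_vector'' ℝ (J (uu L Pf x))
    let g : VP d →ₗ[ℝ] ℝ := (g0.toLinearMap ∘ₗ J)
    have hg : ∀ Q, |g Q| ≤ ‖J Q‖ := by
      intro Q
      have := g0.le_of_opNorm_le hg1 (J Q)
      simpa [g] using this
    have hgx : g (uu L Pf x) = ‖J (uu L Pf x)‖ := hg2
    let f : ℝ → ℝ := fun s => ∑ ℓ ∈ Finset.range (L+1), Real.exp (ℓ * s) * g (Pf ℓ)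
      + η * (s + Real.exp s)
    let f' : ℝ → ℝ := fun s => ∑ ℓ ∈ Finset.range (L+1), Real.exp (ℓ * s) * ℓ * g (Pf ℓ)
      + η * (1 + Real.exp s)
    have hfu : ∀ s, f s = g (uu L Pf s) + η * G s := by
      intro s; simp [f, uu, G]
    have hexp : ∀ (ℓ : ℕ) (y : ℝ), HasDerivAt (fun s => Real.exp (ℓ * s)) (Real.exp (ℓ * y) * ℓ) y := by
      intro ℓ y
      have := ((hasDerivAt_id y).const_mul (ℓ : ℝ)).exp
      simpa using this
    have hf1 : ∀ y, HasDerivAt f (f' y) y := by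
      intro y
      refine HasDerivAt.add (HasDerivAt.fun_sum fun ℓ _ => (hexp ℓ y).mul_const _) ?_
      exact ((hasDerivAt_id y).add (Real.hasDerivAt_exp y)).const_mul η
    have hf2 : HasDerivAt f' (∑ ℓ ∈ Finset.range (L+1), Real.exp (ℓ * x) * ℓ * ℓ * g (Pf ℓ)
      + η * (0 + Real.exp x)) x := by
      refine HasDerivAt.add (HasDerivAt.fun_sum fun ℓ _ => ((hexp ℓ x).mul_const _).mul_const _) ?_
      exact ((hasDerivAt_const x (1:ℝ)).add (Real.hasDerivAt_exp x)).const_mul η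
    have hmax : IsLocalMax f x := by
      filter_upwards [Icc_mem_nhds hgt hlt] with y hy
      have h1 : φ y + η * G y ≤ φ x + η * G x := hxmax hy
      rw [hfu, hfu, hgx]
      have := (le_abs_self _).trans (hg (uu L Pf y))
      simp only [hφ] at h1
      linarith
    have hf0 : f' x = 0 := hmax.hasDerivAt_eq_zero (hf1 x)
    refine no_max hf1 hf2 hf0 ?_ hmax
    have hacc := accr2 J hJ L (fun ℓ => Real.exp (ℓ * x) • Pf ℓ)
      (fun ℓ => Submodule.smul_mem _ _ (hPf ℓ)) g hg hgx
    have e : ∑ ℓ ∈ Finset.range (L+1), ((ℓ : ℝ) * (ℓ + d - 1)) * g (Real.exp (ℓ * x) • Pf ℓ) =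
        ∑ ℓ ∈ Finset.range (L+1), Real.exp (ℓ * x) * ℓ * ℓ * g (Pf ℓ) +
        (d - 1) * ∑ ℓ ∈ Finset.range (L+1), Real.exp (ℓ * x) * ℓ * g (Pf ℓ) := by
      rw [Finset.mul_sum, ← Finset.sum_add_distrib]
      refine Finset.sum_congr rfl fun ℓ _ => ?_
      rw [map_smul, smul_eq_mul]; ring
    rw [e] at hacc
    simp only [f'] at hf0
    have hE := Real.exp_pos x
    have h3 : ∑ ℓ ∈ Finset.range (L+1), Real.exp (ℓ * x) * ℓ * g (Pf ℓ) = - (η * (1 + Real.exp x)) := by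
      linarith
    rw [h3] at hacc
    have h4 : 0 ≤ (d - 1 : ℝ) * (η * (1 + Real.exp x)) := by positivity
    have h5 : 0 < η * Real.exp x := by positivity
    linarith
  have hG : G a ≤ G b := by simp only [G]; gcongr
  refine le_of_forall_pos_le_add fun ε hε => ?_
  have := main (ε / (G b - G a + 1)) (div_pos hε (by linarith))
  have h2 : ε / (G b - G a + 1) * (G b - G a) ≤ ε := by
    rw [div_mul_eq_mul_div, div_le_iff₀ (by linarith)]
    nlinarith
  show φ a ≤ φ b + ε
  nlinarith

lemma bern_iter (hJ : ∀ i j, i ≠ j → ∀ c s : ℝ, c ^ 2 + s ^ 2 = 1 → ∀ P, ‖J (rot d i j c s P)‖ = ‖J P‖)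
    (L : ℕ) (hL : 1 ≤ L) (ν : ℝ) (hν : 2 * ν = d - 1) (Pf : ℕ → VP d)
    (hPf : ∀ ℓ, Pf ℓ ∈ harmHomog d ℓ) (k : ℕ) :
    ‖J (∑ ℓ ∈ Finset.range (L+1), (((ℓ : ℝ) + ν) ^ (2 * k)) • Pf ℓ)‖ ≤
      ((d + 1 + |ν|) * L) ^ (2 * k) * ‖J (∑ ℓ ∈ Finset.range (L+1), Pf ℓ)‖ := by
  induction k with
  | zero => simp
  | succ k ih =>
    set R : ℕ → VP d := fun ℓ => (((ℓ : ℝ) + ν) ^ (2 * k)) • Pf ℓ with hR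
    have hRh : ∀ ℓ, R ℓ ∈ harmHomog d ℓ := fun ℓ => Submodule.smul_mem _ _ (hPf ℓ)
    have e : ∑ ℓ ∈ Finset.range (L+1), (((ℓ : ℝ) + ν) ^ (2 * (k + 1))) • Pf ℓ =
        ∑ ℓ ∈ Finset.range (L+1), ((ℓ : ℝ) * (ℓ + d - 1)) • R ℓ
        + (ν ^ 2) • ∑ ℓ ∈ Finset.range (L+1), R ℓ := by
      rw [Finset.smul_sum, ← Finset.sum_add_distrib]
      refine Finset.sum_congr rfl fun ℓ _ => ?_
      rw [hR]; simp only [smul_smul, ← add_smul]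
      congr 1
      rw [add_sub_assoc, ← hν]; ring
    rw [e, map_add, map_smul]
    refine (norm_add_le _ _).trans ?_
    have hb := bern2 J hJ L R hRh
    rw [norm_smul, Real.norm_eq_abs, abs_pow]
    set N := ‖J (∑ ℓ ∈ Finset.range (L+1), R ℓ)‖
    have hL' : (1:ℝ) ≤ L := by exact_mod_cast hL
    have hN : 0 ≤ N := norm_nonneg _
    calc _ ≤ (d + 1) ^ 2 * L ^ 2 * N + |ν| ^ 2 * N := by linarith
      _ ≤ ((d + 1 + |ν|) * L) ^ 2 * N := by
          rw [← add_mul]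
          gcongr
          have : |ν| ^ 2 * 1 ≤ |ν| ^ 2 * L ^ 2 := by
            gcongr; nlinarith
          have : 0 ≤ (d + 1 : ℝ) * |ν| * L ^ 2 := by positivity
          nlinarith
      _ ≤ ((d + 1 + |ν|) * L) ^ 2 * (((d + 1 + |ν|) * L) ^ (2 * k) * ‖J (∑ ℓ ∈ Finset.range (L+1), Pf ℓ)‖) := by
          gcongr
      _ = _ := by ring

lemma growth_uu (hd : 1 ≤ d)
    (hJ : ∀ i j, i ≠ j → ∀ c s : ℝ, c ^ 2 + s ^ 2 = 1 → ∀ P, ‖J (rot d i j c s P)‖ = ‖J P‖)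
    (L : ℕ) (hL : 1 ≤ L) (Pf : ℕ → VP d) (hPf : ∀ ℓ, Pf ℓ ∈ harmHomog d ℓ) {s : ℝ} (hs : 0 ≤ s) :
    ‖J (uu L Pf s)‖ ≤ (2 * Real.cosh ((2 * d + 1) * (L * s)) + 1) * ‖J (uu L Pf 0)‖ := by
  have hd1 : (1:ℝ) ≤ d := by exact_mod_cast hd
  set ν : ℝ := (d - 1) / 2 with hν
  have hν0 : 0 ≤ ν := by rw [hν]; linarith
  obtain ⟨g0, hg1, hg2⟩ := exists_dual_vector'' ℝ (J (uu L Pf s))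
  let g : VP d →ₗ[ℝ] ℝ := (g0.toLinearMap ∘ₗ J)
  have hg : ∀ Q, |g Q| ≤ ‖J Q‖ := by
    intro Q
    have := g0.le_of_opNorm_le hg1 (J Q)
    simpa [g] using this
  have hgx : g (uu L Pf s) = ‖J (uu L Pf s)‖ := hg2
  have hu0 : uu L Pf 0 = ∑ ℓ ∈ Finset.range (L+1), Pf ℓ := by simp [uu]
  set M := ‖J (uu L Pf 0)‖ with hM
  set K : ℝ := (d + 1 + |ν|) * L with hK
  -- cosh identity
  have hsum : HasSum (fun k : ℕ => s ^ (2 * k) / ((2 * k).factorial : ℝ) *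
      g (∑ ℓ ∈ Finset.range (L+1), (((ℓ : ℝ) + ν) ^ (2 * k)) • Pf ℓ))
      (∑ ℓ ∈ Finset.range (L+1), Real.cosh ((ℓ + ν) * s) * g (Pf ℓ)) := by
    have : (fun k : ℕ => s ^ (2 * k) / ((2 * k).factorial : ℝ) *
      g (∑ ℓ ∈ Finset.range (L+1), (((ℓ : ℝ) + ν) ^ (2 * k)) • Pf ℓ)) =
      fun k : ℕ => ∑ ℓ ∈ Finset.range (L+1), (((ℓ + ν) * s) ^ (2 * k) / ((2 * k).factorial : ℝ)) * g (Pf ℓ) := by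
      funext k
      rw [map_sum, Finset.mul_sum]
      refine Finset.sum_congr rfl fun ℓ _ => ?_
      rw [map_smul, smul_eq_mul, mul_pow]; ring
    rw [this]
    exact hasSum_sum fun ℓ _ => (Real.hasSum_cosh _).mul_right _
  have hbound : ∑ ℓ ∈ Finset.range (L+1), Real.cosh ((ℓ + ν) * s) * g (Pf ℓ) ≤ Real.cosh (K * s) * M := by
    refine hasSum_le (fun k => ?_) hsum ((Real.hasSum_cosh (K * s)).mul_right M)
    have h1 := (le_abs_self _).trans
      ((hg _).trans (bern_iter J hJ L hL ν (by rw [hν]; ring) Pf hPf k))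
    rw [← hu0, ← hM, ← hK] at h1
    calc _ ≤ s ^ (2 * k) / ((2 * k).factorial : ℝ) * (K ^ (2 * k) * M) := by gcongr
      _ = (K * s) ^ (2 * k) / ((2 * k).factorial : ℝ) * M := by rw [mul_pow K s, aux_alg]
  have hsplit : 2 * ∑ ℓ ∈ Finset.range (L+1), Real.cosh ((ℓ + ν) * s) * g (Pf ℓ) =
      Real.exp (ν * s) * g (uu L Pf s) + Real.exp (-(ν * s)) * g (uu L Pf (-s)) := by
    simp only [uu, map_sum, map_smul, smul_eq_mul]
    rw [Finset.mul_sum, Finset.mul_sum, Finset.mul_sum, ← Finset.sum_add_distrib]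
    refine Finset.sum_congr rfl fun ℓ _ => ?_
    rw [Real.cosh_eq, ← mul_assoc, ← mul_assoc (Real.exp (ν * s)), ← mul_assoc (Real.exp (-(ν * s))),
      ← Real.exp_add, ← Real.exp_add,
      show -(((ℓ : ℝ) + ν) * s) = -(ν * s) + ℓ * -s by ring,
      show ((ℓ : ℝ) + ν) * s = ν * s + ℓ * s by ring]
    ring
  have hneg : |g (uu L Pf (-s))| ≤ M := (hg _).trans (mono_uu J hd hJ L Pf hPf (by linarith))
  have hneg' := (abs_le.1 hneg).1
  have he1 : 1 ≤ Real.exp (ν * s) := Real.one_le_exp (by positivity)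
  have he2 : Real.exp (-(ν * s)) ≤ 1 := Real.exp_le_one_iff.2 (by simp; positivity)
  have he3 := Real.exp_pos (-(ν * s))
  have hM0 : 0 ≤ M := norm_nonneg _
  have hcosh : Real.cosh (K * s) ≤ Real.cosh ((2 * d + 1) * (L * s)) := by
    rw [Real.cosh_le_cosh, abs_of_nonneg (by positivity), abs_of_nonneg (by positivity), hK, mul_assoc]
    refine mul_le_mul_of_nonneg_right ?_ (by positivity)
    rw [abs_of_nonneg hν0, hν]; linarith
  have hn := norm_nonneg (J (uu L Pf s))
  calc ‖J (uu L Pf s)‖ ≤ Real.exp (ν * s) * ‖J (uu L Pf s)‖ := by nlinarith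
    _ ≤ 2 * (Real.cosh (K * s) * M) + M := by
      rw [← hgx]
      nlinarith
    _ ≤ 2 * (Real.cosh ((2 * d + 1) * (L * s)) * M) + M := by gcongr
    _ = _ := by ring
end abstr2

lemma polar_lint (d : ℕ) (f : Esp d → ℝ≥0∞) (hf : Measurable f) :
    ∫⁻ x, f x = ∫⁻ r in Set.Ioi (0:ℝ), ENNReal.ofReal (r ^ d) *
      ∫⁻ ω : Sph d, f (r • (ω : Esp d)) ∂(sphMeasure d) := by
  have hfr : Module.finrank ℝ (Esp d) - 1 = d := by simp
  have hmp := (volume : Measure (Esp d)).measurePreserving_homeomorphUnitSphereProd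
  rw [hfr] at hmp
  have hsm : Measurable (fun y : Sph d × Set.Ioi (0:ℝ) => f ((y.2 : ℝ) • (y.1 : Esp d))) := by
    apply hf.comp
    fun_prop
  calc ∫⁻ x, f x = ∫⁻ x : ({(0)}ᶜ : Set (Esp d)), f x ∂((volume : Measure (Esp d)).comap Subtype.val) := by
        rw [lintegral_subtype_comap (measurableSet_singleton _).compl f, restrict_compl_singleton]
    _ = ∫⁻ y : Sph d × Set.Ioi (0:ℝ), f ((y.2 : ℝ) • (y.1 : Esp d)) ∂((volume : Measure (Esp d)).toSphere.prod
          (.volumeIoiPow d)) := by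
        rw [← hmp.lintegral_comp hsm]
        refine lintegral_congr fun x => ?_
        congr 1
        have hx : (x : Esp d) ≠ 0 := x.2
        simp [smul_smul, hx]
    _ = ∫⁻ r : Set.Ioi (0:ℝ), (∫⁻ ω : Sph d, f ((r : ℝ) • (ω : Esp d)) ∂(sphMeasure d)) ∂(.volumeIoiPow d) := by
        rw [lintegral_prod_symm _ hsm.aemeasurable]; rfl
    _ = _ := by
        have hm2 : Measurable (fun r : Set.Ioi (0:ℝ) => ∫⁻ ω : Sph d, f ((r : ℝ) • (ω : Esp d)) ∂(volume : Measure (Esp d)).toSphere) :=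
          hsm.lintegral_prod_left'
        rw [Measure.volumeIoiPow, sphMeasure, lintegral_withDensity_eq_lintegral_mul _ (by fun_prop) hm2,
          ← lintegral_subtype_comap measurableSet_Ioi]
        rfl

instance sphFin (d : ℕ) : IsFiniteMeasure (sphMeasure d) := by unfold sphMeasure; infer_instance

open scoped Pointwise in
lemma sph_invariant (d : ℕ) (T : Esp d ≃ₗᵢ[ℝ] Esp d) (f : Esp d → ℝ≥0∞) (hf : Measurable f) :
    ∫⁻ ω : Sph d, f (T ω) ∂(sphMeasure d) = ∫⁻ ω : Sph d, f ω ∂(sphMeasure d) := by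
  let τ : Sph d → Sph d := fun ω => ⟨T ω, by simp⟩
  have hτ : Measurable τ := by
    apply Continuous.measurable
    exact Continuous.subtype_mk (T.continuous.comp continuous_subtype_val) _
  have hmp : MeasurePreserving τ (sphMeasure d) (sphMeasure d) := by
    refine ⟨hτ, ?_⟩
    ext s hs
    rw [Measure.map_apply hτ hs, sphMeasure, Measure.toSphere_apply' _ hs,
      Measure.toSphere_apply' _ (hτ hs)]
    congr 1
    rw [← ((T.symm.measurePreserving).measure_preimage_emb (f := T.symm) T.symm.toHomeomorph.measurableEmbedding (Set.Ioo (0:ℝ) 1 • (Subtype.val '' (τ ⁻¹' s))))]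
    congr 1
    ext x
    simp only [Set.mem_smul, Set.mem_image, Set.mem_preimage]
    constructor
    · rintro ⟨r, hr, _, ⟨ω, hω, rfl⟩, h⟩
      refine ⟨r, hr, _, ⟨τ ω, hω, rfl⟩, ?_⟩
      apply T.symm.injective
      simpa [τ] using h
    · rintro ⟨r, hr, _, ⟨ω, hω, rfl⟩, rfl⟩
      refine ⟨r, hr, _, ⟨⟨T.symm ω, by simp⟩, ?_, rfl⟩, ?_⟩
      · simpa [τ] using hω
      · simp
  exact hmp.lintegral_comp (f := fun ω : Sph d => f ω) (hf.comp measurable_subtype_coe)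

def rotF (d : ℕ) (i j : Fin (d+1)) (c s : ℝ) : Esp d →ₗ[ℝ] Esp d where
  toFun x := WithLp.toLp 2 fun k => x k + (c - 1) * ((if k = i then x i else 0) + (if k = j then x j else 0))
    + s * ((if k = i then x j else 0) - (if k = j then x i else 0))
  map_add' x y := by
    ext k; simp only [PiLp.add_apply]
    split_ifs <;> ring
  map_smul' r x := by
    ext k; simp only [PiLp.smul_apply, smul_eq_mul, RingHom.id_apply]
    split_ifs <;> ring

lemma rotF_norm (d : ℕ) (i j : Fin (d+1)) (hij : i ≠ j) (c s : ℝ) (h : c ^ 2 + s ^ 2 = 1) (x : Esp d) :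
    ‖rotF d i j c s x‖ = ‖x‖ := by
  rw [EuclideanSpace.norm_eq, EuclideanSpace.norm_eq]
  congr 1
  simp only [Real.norm_eq_abs, sq_abs]
  have e : ∀ k, (rotF d i j c s x k) ^ 2 = x k ^ 2 + ((if k = i then (c * x i + s * x j) ^ 2 - x i ^ 2 else 0)
      + (if k = j then (c * x j - s * x i) ^ 2 - x j ^ 2 else 0)) := by
    intro k
    simp only [rotF, LinearMap.coe_mk, AddHom.coe_mk]
    by_cases h1 : k = i
    · subst h1
      simp [hij]; ring
    · by_cases h2 : k = j
      · subst h2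
        simp [h1]; ring
      · simp [h1, h2]
  simp only [e, Finset.sum_add_distrib, Finset.sum_ite_eq', Finset.mem_univ, if_true]
  linear_combination (x i ^ 2 + x j ^ 2) * h

def rotI (d : ℕ) (i j : Fin (d+1)) (hij : i ≠ j) (c s : ℝ) (h : c ^ 2 + s ^ 2 = 1) : Esp d ≃ₗᵢ[ℝ] Esp d :=
  LinearIsometry.toLinearIsometryEquiv ⟨rotF d i j c s, rotF_norm d i j hij c s h⟩ rfl

lemma eval_rot (d : ℕ) (i j : Fin (d+1)) (c s : ℝ) (P : VP d) (x : Esp d) :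
    eval (fun k => x k) (rot d i j c s P) = eval (fun k => rotF d i j c s x k) P := by
  have : (eval (fun k => x k)).comp (rot d i j c s).toRingHom = eval (fun k => rotF d i j c s x k) := by
    apply MvPolynomial.ringHom_ext
    · intro r; simp [rot]
    · intro k
      simp only [rot, rotF, ak, bk, RingHom.comp_apply, AlgHom.toRingHom_eq_coe, RingHom.coe_coe, aeval_X,
        map_add, map_mul, map_sub, eval_X, eval_C, LinearMap.coe_mk, AddHom.coe_mk]
      split_ifs <;> simp
  exact congrArg (fun g : _ →+* ℝ => g P) this

def JJ (d : ℕ) (p : ℝ≥0∞) [Fact (1 ≤ p)] : VP d →ₗ[ℝ] Lp ℝ p (sphMeasure d) :=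
  (ContinuousMap.toLp (E := ℝ) p (sphMeasure d) ℝ).toLinearMap ∘ₗ
  { toFun := fun P => (⟨fun ω => eval (fun i => (ω : Esp d) i) P, by
        exact (MvPolynomial.continuous_eval P).comp (by fun_prop)⟩ : C(Sph d, ℝ))
    map_add' := fun P Q => by ext; simp
    map_smul' := fun r P => by ext; simp [smul_eval] }

lemma JJ_norm (d : ℕ) (p : ℝ) (hp : 1 ≤ p) [Fact (1 ≤ ENNReal.ofReal p)] (P : VP d) :
    ENNReal.ofReal (‖JJ d (ENNReal.ofReal p) P‖ ^ p) =
      ∫⁻ ω : Sph d, ENNReal.ofReal (|eval (fun i => (ω : Esp d) i) P| ^ p) ∂(sphMeasure d) := by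
  have hp0 : 0 < p := by linarith
  rw [← ENNReal.ofReal_rpow_of_nonneg (norm_nonneg _) hp0.le, ofReal_norm, Lp.enorm_def]
  have h1 : (JJ d (ENNReal.ofReal p) P : Sph d → ℝ) =ᵐ[sphMeasure d] fun ω => eval (fun i => (ω : Esp d) i) P :=
    ContinuousMap.coeFn_toLp _ _
  rw [eLpNorm_congr_ae h1, eLpNorm_eq_lintegral_rpow_enorm_toReal (by simpa using hp0) (by simp),
    ENNReal.toReal_ofReal hp0.le, ← ENNReal.rpow_mul, one_div_mul_cancel hp0.ne', ENNReal.rpow_one]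
  refine lintegral_congr fun ω => ?_
  rw [← ENNReal.ofReal_rpow_of_nonneg (abs_nonneg _) hp0.le, Real.enorm_eq_ofReal_abs]

lemma JJ_rot (d : ℕ) (p : ℝ) (hp : 1 ≤ p) [Fact (1 ≤ ENNReal.ofReal p)] (i j : Fin (d+1)) (hij : i ≠ j)
    (c s : ℝ) (h : c ^ 2 + s ^ 2 = 1) (P : VP d) :
    ‖JJ d (ENNReal.ofReal p) (rot d i j c s P)‖ = ‖JJ d (ENNReal.ofReal p) P‖ := by
  have hp0 : 0 < p := by linarith
  have key : ENNReal.ofReal (‖JJ d (ENNReal.ofReal p) (rot d i j c s P)‖ ^ p) =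
      ENNReal.ofReal (‖JJ d (ENNReal.ofReal p) P‖ ^ p) := by
    rw [JJ_norm d p hp, JJ_norm d p hp]
    have := sph_invariant d (rotI d i j hij c s h)
      (fun x => ENNReal.ofReal (|eval (fun i => x i) P| ^ p)) (by
        have : Continuous fun x : Esp d => eval (fun i => x i) P :=
          (MvPolynomial.continuous_eval P).comp (by fun_prop)
        have := this.measurable
        fun_prop)
    rw [← this]
    refine lintegral_congr fun ω => ?_
    rw [eval_rot]; rfl
  rw [ENNReal.ofReal_eq_ofReal_iff (by positivity) (by positivity)] at key
  exact (Real.rpow_left_inj (norm_nonneg _) (norm_nonneg _) hp0.ne').1 key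

lemma exists_decomp (d L : ℕ) (P : VP d) (hP : P ∈ harmPolyLe d L) :
    ∃ Pf : ℕ → VP d, (∀ ℓ, Pf ℓ ∈ harmHomog d ℓ) ∧ P = ∑ ℓ ∈ Finset.range (L+1), Pf ℓ := by
  unfold harmPolyLe at hP
  induction hP using Submodule.iSup_induction' with
  | mem i x hx =>
    refine ⟨fun ℓ => if ℓ = i then x else 0, fun ℓ => ?_, ?_⟩
    · dsimp only
      split_ifs with h
      · rw [h]; exact hx
      · exact zero_mem _
    · rw [Finset.sum_ite_eq', if_pos (Finset.mem_range.2 i.2)]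
  | zero => exact ⟨fun _ => 0, fun _ => zero_mem _, by simp⟩
  | add x y _ _ hx hy =>
    obtain ⟨f, hf, rfl⟩ := hx
    obtain ⟨g, hg, rfl⟩ := hy
    exact ⟨fun ℓ => f ℓ + g ℓ, fun ℓ => add_mem (hf ℓ) (hg ℓ), by rw [Finset.sum_add_distrib]⟩

lemma eval_homog (d ℓ : ℕ) (Q : VP d) (hQ : Q.IsHomogeneous ℓ) (r : ℝ) (x : Esp d) :
    eval (fun i => (r • x) i) Q = r ^ ℓ * eval (fun i => x i) Q := by
  rw [eval_eq, eval_eq, Finset.mul_sum]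
  refine Finset.sum_congr rfl fun m hm => ?_
  have hdeg : ∑ i ∈ m.support, m i = ℓ := by
    have := hQ (mem_support_iff.1 hm)
    rw [← this]
    simp [Finsupp.weight_apply, Finsupp.sum]
  simp only [PiLp.smul_apply, smul_eq_mul, mul_pow, Finset.prod_mul_distrib]
  rw [Finset.prod_pow_eq_pow_sum, hdeg]
  ring

lemma eval_uu (d L : ℕ) (Pf : ℕ → VP d) (hPf : ∀ ℓ, Pf ℓ ∈ harmHomog d ℓ) (r : ℝ) (hr : 0 < r) (x : Esp d) :
    eval (fun i => (r • x) i) (∑ ℓ ∈ Finset.range (L+1), Pf ℓ) = eval (fun i => x i) (uu L Pf (Real.log r)) := by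
  rw [uu, map_sum, map_sum]
  refine Finset.sum_congr rfl fun ℓ _ => ?_
  have h : (Pf ℓ).IsHomogeneous ℓ := (mem_homogeneousSubmodule ℓ _).1 (hPf ℓ).1
  rw [eval_homog d ℓ _ h, smul_eval, mul_comm (ℓ : ℝ), Real.exp_mul, Real.exp_log hr, Real.rpow_natCast]

lemma shell_lint (d L : ℕ) (p ε : ℝ) (hp : 1 ≤ p) [Fact (1 ≤ ENNReal.ofReal p)] (Pf : ℕ → VP d)
    (hPf : ∀ ℓ, Pf ℓ ∈ harmHomog d ℓ) :
    ∫⁻ x in {x : Esp d | |‖x‖ - 1| < ε},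
      ENNReal.ofReal (|eval (fun i => x i) (∑ ℓ ∈ Finset.range (L+1), Pf ℓ)| ^ p) =
    ∫⁻ r in Set.Ioi (0:ℝ), Set.indicator {r : ℝ | |r - 1| < ε}
      (fun r => ENNReal.ofReal (r ^ d) * ENNReal.ofReal (‖JJ d (ENNReal.ofReal p) (uu L Pf (Real.log r))‖ ^ p)) r := by
  have hS : MeasurableSet {x : Esp d | |‖x‖ - 1| < ε} := by
    apply measurableSet_lt <;> fun_prop
  rw [← lintegral_indicator hS, polar_lint]
  · refine setLIntegral_congr_fun measurableSet_Ioi fun r hr => ?_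
    have hr' : (0:ℝ) < r := hr
    have hn : ∀ ω : Sph d, ‖r • (ω : Esp d)‖ = r := by
      intro ω; rw [norm_smul]; simp [abs_of_pos hr']
    by_cases h : |r - 1| < ε
    · have h' : r ∈ {r : ℝ | |r - 1| < ε} := h
      simp only [Set.indicator_of_mem h']
      rw [JJ_norm d p hp]
      congr 1
      refine lintegral_congr fun ω => ?_
      rw [Set.indicator_of_mem (by simpa [hn] using h), eval_uu d L Pf hPf r hr']
    · have h' : r ∉ {r : ℝ | |r - 1| < ε} := h
      simp only [Set.indicator_of_notMem h']
      have : ∀ ω : Sph d, Set.indicator {x : Esp d | |‖x‖ - 1| < ε} (fun x => 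
         ENNReal.ofReal (|eval (fun i => x i) (∑ ℓ ∈ Finset.range (L+1), Pf ℓ)| ^ p)) (r • (ω : Esp d)) = 0 := by
        intro ω
        rw [Set.indicator_of_notMem (by simpa [hn] using h)]
      simp only [this]; simp
  · apply Measurable.indicator _ hS
    have : Continuous fun x : Esp d => eval (fun i => x i) (∑ ℓ ∈ Finset.range (L+1), Pf ℓ) :=
      (MvPolynomial.continuous_eval _).comp (by fun_prop)
    have := this.measurable
    fun_prop

theorem stmt13 (d : ℕ) (hd : 1 ≤ d) (ρ p : ℝ) (hρ : 0 < ρ) (hp : 1 ≤ p) :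
    ∃ c C : ℝ, 0 < c ∧ 0 < C ∧ ∀ L : ℕ, 1 ≤ L → ∀ P ∈ harmPolyLe d L,
      c * ∫ ω : Sph d, |eval (fun i => (ω : Esp d) i) P| ^ p ∂(sphMeasure d)
        ≤ (L : ℝ) * ∫ x in {x : Esp d | |‖x‖ - 1| < ρ / L},
            |eval (fun i => x i) P| ^ p ∂(volume : Measure (Esp d)) ∧
      (L : ℝ) * ∫ x in {x : Esp d | |‖x‖ - 1| < ρ / L},
            |eval (fun i => x i) P| ^ p ∂(volume : Measure (Esp d))
        ≤ C * ∫ ω : Sph d, |eval (fun i => (ω : Esp d) i) P| ^ p ∂(sphMeasure d) := by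
  have hp0 : 0 < p := by linarith
  haveI : Fact (1 ≤ ENNReal.ofReal p) := ⟨by simpa using hp⟩
  set C1 : ℝ := 2 * Real.cosh ((2 * d + 1) * ρ) + 1 with hC1
  have hC1' : 1 ≤ C1 := by have := Real.cosh_pos ((2 * d + 1) * ρ); rw [hC1]; linarith
  have hC10 : 0 < C1 := by linarith
  refine ⟨ρ, 2 * ρ * ((1 + ρ) ^ d * C1 ^ p), hρ, by positivity, ?_⟩
  intro L hL P hP
  have hL1 : (1:ℝ) ≤ L := by exact_mod_cast hL
  have hL0 : (0:ℝ) < L := by linarith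
  obtain ⟨Pf, hPf, rfl⟩ := exists_decomp d L P hP
  set P : VP d := ∑ ℓ ∈ Finset.range (L+1), Pf ℓ with hPdef
  have hu0 : uu L Pf 0 = P := by simp [uu, hPdef]
  let J := JJ d (ENNReal.ofReal p)
  have hJ : ∀ i j, i ≠ j → ∀ c s : ℝ, c ^ 2 + s ^ 2 = 1 → ∀ P, ‖J (rot d i j c s P)‖ = ‖J P‖ :=
    fun i j hij c s h P => JJ_rot d p hp i j hij c s h P
  set N : ℝ := ‖J P‖ with hN
  have hN0 : 0 ≤ N := norm_nonneg _
  set ε : ℝ := ρ / L with hε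
  have hε0 : 0 < ε := by positivity
  have hερ : ε ≤ ρ := div_le_self hρ.le hL1
  have hLε : L * ε = ρ := by rw [hε]; field_simp
  have hcont : Continuous fun x : Esp d => |eval (fun i => x i) P| ^ p := by
    have : Continuous fun x : Esp d => eval (fun i => x i) P :=
      (MvPolynomial.continuous_eval _).comp (by fun_prop)
    exact this.abs.rpow_const fun _ => Or.inr hp0.le
  -- sphere integral
  have hsph : ∫ ω : Sph d, |eval (fun i => (ω : Esp d) i) P| ^ p ∂(sphMeasure d) = N ^ p := by
    have hc2 : Continuous fun ω : Sph d => |eval (fun i => (ω : Esp d) i) P| ^ p :=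
      hcont.comp continuous_subtype_val
    rw [integral_eq_lintegral_of_nonneg_ae (Filter.Eventually.of_forall fun _ => by positivity)
      hc2.aestronglyMeasurable]
    rw [← JJ_norm d p hp, ENNReal.toReal_ofReal (by positivity)]
  have hsh : ∫ x in {x : Esp d | |‖x‖ - 1| < ε}, |eval (fun i => x i) P| ^ p ∂(volume : Measure (Esp d)) =
      (∫⁻ r in Set.Ioi (0:ℝ), Set.indicator {r : ℝ | |r - 1| < ε}
      (fun r => ENNReal.ofReal (r ^ d) * ENNReal.ofReal (‖J (uu L Pf (Real.log r))‖ ^ p)) r).toReal := by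
    rw [integral_eq_lintegral_of_nonneg_ae (Filter.Eventually.of_forall fun _ => by positivity)
      hcont.aestronglyMeasurable, shell_lint d L p ε hp Pf hPf]
  set I := ∫⁻ r in Set.Ioi (0:ℝ), Set.indicator {r : ℝ | |r - 1| < ε}
      (fun r => ENNReal.ofReal (r ^ d) * ENNReal.ofReal (‖J (uu L Pf (Real.log r))‖ ^ p)) r with hI
  have hlow : ENNReal.ofReal (ε * N ^ p) ≤ I := by
    calc ENNReal.ofReal (ε * N ^ p) = ∫⁻ r in Set.Ioi (0:ℝ), Set.indicator (Set.Ico 1 (1 + ε))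
          (fun _ => ENNReal.ofReal (N ^ p)) r := by
          have hsub : Set.Ico (1:ℝ) (1 + ε) ⊆ Set.Ioi 0 := fun r hr => lt_of_lt_of_le one_pos hr.1
          rw [lintegral_indicator measurableSet_Ico, setLIntegral_const,
            Measure.restrict_apply measurableSet_Ico,
            Set.inter_eq_left.2 hsub, Real.volume_Ico,
            ENNReal.ofReal_mul hε0.le, mul_comm, add_sub_cancel_left]
      _ ≤ I := by
        refine lintegral_mono fun r => ?_
        by_cases hr : r ∈ Set.Ico 1 (1 + ε)
        · have hr' : r ∈ {r : ℝ | |r - 1| < ε} := by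
            show |r - 1| < ε
            rw [abs_of_nonneg (by linarith [hr.1])]; linarith [hr.2]
          rw [Set.indicator_of_mem hr, Set.indicator_of_mem hr', ← ENNReal.ofReal_mul (pow_nonneg (by linarith [hr.1]) _)]
          apply ENNReal.ofReal_le_ofReal
          have h1 : N ≤ ‖J (uu L Pf (Real.log r))‖ := by
            rw [hN, ← hu0]; exact mono_uu J hd hJ L Pf hPf (Real.log_nonneg hr.1)
          have h2 : N ^ p ≤ ‖J (uu L Pf (Real.log r))‖ ^ p := Real.rpow_le_rpow hN0 h1 hp0.le
          have h3 : 1 ≤ r ^ d := one_le_pow₀ hr.1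
          have h4 : 0 ≤ N ^ p := by positivity
          nlinarith
        · rw [Set.indicator_of_notMem hr]; exact zero_le
  have hup : I ≤ ENNReal.ofReal (2 * ε * ((1 + ρ) ^ d * (C1 * N) ^ p)) := by
    calc I ≤ ∫⁻ r in Set.Ioi (0:ℝ), Set.indicator (Set.Ioo (1 - ε) (1 + ε))
          (fun _ => ENNReal.ofReal ((1 + ρ) ^ d * (C1 * N) ^ p)) r := by
          refine setLIntegral_mono' measurableSet_Ioi fun r hr0 => ?_
          have hr0 : (0:ℝ) < r := hr0
          by_cases hr : |r - 1| < ε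
          · have hr' : r ∈ {r : ℝ | |r - 1| < ε} := hr
            have hr2 := abs_lt.1 hr
            rw [Set.indicator_of_mem hr', Set.indicator_of_mem (by constructor <;> linarith),
              ← ENNReal.ofReal_mul (by positivity)]
            apply ENNReal.ofReal_le_ofReal
            have h1 : ‖J (uu L Pf (Real.log r))‖ ≤ C1 * N := by
              rcases le_total r 1 with h | h
              · have : ‖J (uu L Pf (Real.log r))‖ ≤ N := by
                  rw [hN, ← hu0]
                  exact mono_uu J hd hJ L Pf hPf (Real.log_nonpos hr0.le h)
                nlinarith
              · have hl := Real.log_nonneg h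
                have hl2 : Real.log r ≤ ε := by
                  have := Real.log_le_sub_one_of_pos hr0
                  linarith
                refine (growth_uu J hd hJ L hL Pf hPf hl).trans ?_
                rw [hu0, ← hN]
                refine mul_le_mul_of_nonneg_right ?_ hN0
                rw [hC1]
                have : Real.cosh ((2 * d + 1) * (L * Real.log r)) ≤ Real.cosh ((2 * d + 1) * ρ) := by
                  rw [Real.cosh_le_cosh, abs_of_nonneg (by positivity), abs_of_nonneg (by positivity), ← hLε]
                  gcongr
                linarith
            have h5 : r ≤ 1 + ρ := by linarith
            gcongr
          · have hr' : r ∉ {r : ℝ | |r - 1| < ε} := hr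
            rw [Set.indicator_of_notMem hr']; exact zero_le
      _ ≤ ∫⁻ r : ℝ, Set.indicator (Set.Ioo (1 - ε) (1 + ε))
          (fun _ => ENNReal.ofReal ((1 + ρ) ^ d * (C1 * N) ^ p)) r := setLIntegral_le_lintegral _ _
      _ = _ := by
          rw [lintegral_indicator measurableSet_Ioo, setLIntegral_const, Real.volume_Ioo,
            mul_comm, ← ENNReal.ofReal_mul (by linarith)]
          congr 2; ring
  have hfin : I ≠ ⊤ := ne_top_of_le_ne_top ENNReal.ofReal_ne_top hup
  rw [hsph, hsh]
  constructor
  · have := (ENNReal.ofReal_le_iff_le_toReal hfin).1 hlow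
    calc ρ * N ^ p = L * (ε * N ^ p) := by rw [← hLε]; ring
      _ ≤ _ := by gcongr
  · have h6 : I.toReal ≤ 2 * ε * ((1 + ρ) ^ d * (C1 * N) ^ p) :=
      ENNReal.toReal_le_of_le_ofReal (by positivity) hup
    calc L * I.toReal ≤ L * (2 * ε * ((1 + ρ) ^ d * (C1 * N) ^ p)) := by gcongr
      _ = 2 * (L * ε) * ((1 + ρ) ^ d * (C1 * N) ^ p) := by ring
      _ = _ := by rw [hLε, Real.mul_rpow hC10.le hN0]; ring
end
end

section
/- There is a constant C depending only on d and p such that for all L ≥ 1, Q ∈ Π_L, and u ∈ S^d: |Q(u)|^p ≤ C · L^{d+1} · ∫_{B(u, 1/L)} |Q(x)|^p dm(x), where B(u, 1/L) is the Euclidean ball in R^{d+1} of center u and radius 1/L, and Q is extended harmonically to R^{d+1}. Consequently ‖Q‖_∞^p ≤ C' · L^d · ‖Q‖_{L^p(S^d)}^p. -/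
open MeasureTheory MvPolynomial
open scoped RealInnerProductSpace ENNReal

noncomputable section

/-- evaluation of a polynomial at a point of Euclidean space -/
def ev (d : ℕ) (P : MvPolynomial (Fin (d+1)) ℝ) (x : Esp d) : ℝ := eval (fun i => x i) P

theorem ev_cont (d : ℕ) (P : MvPolynomial (Fin (d+1)) ℝ) : Continuous (ev d P) := by
  unfold ev
  exact P.continuous_eval.comp (by fun_prop)

theorem ev_fderiv (d : ℕ) (P : MvPolynomial (Fin (d+1)) ℝ) (x : Esp d) :
    HasFDerivAt (ev d P)
      (∑ i, ev d (pderiv i P) x • (EuclideanSpace.proj i : Esp d →L[ℝ] ℝ)) x := by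
  induction P using MvPolynomial.induction_on with
  | C a =>
    refine ((hasFDerivAt_const (𝕜 := ℝ) a x).congr_fderiv ?_).congr_of_eventuallyEq ?_
    · simp [ev]
    · filter_upwards with y; simp [ev]
  | add p q hp hq =>
    have := hp.add hq
    refine (this.congr_fderiv ?_).congr_of_eventuallyEq ?_
    · simp [ev, add_smul, Finset.sum_add_distrib]
    · filter_upwards with y; simp [ev]
  | mul_X p j hp =>
    have hj : HasFDerivAt (fun y : Esp d => y j)
        (EuclideanSpace.proj j : Esp d →L[ℝ] ℝ) x :=
      (EuclideanSpace.proj j : Esp d →L[ℝ] ℝ).hasFDerivAt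
    have := hp.mul hj
    refine (this.congr_fderiv ?_).congr_of_eventuallyEq ?_
    · ext v
      simp [ev, Finset.sum_add_distrib, add_mul, Finset.mul_sum, pderiv_X, Pi.single_apply,
        apply_ite, ite_mul]
      apply Finset.sum_congr rfl; intros; ring1
    · filter_upwards with y; simp [ev]

theorem ev_hasDerivAt (d : ℕ) (P : MvPolynomial (Fin (d+1)) ℝ) (u x : Esp d) (t : ℝ) :
    HasDerivAt (fun t : ℝ => ev d P (u + t • x)) (∑ i, ev d (pderiv i P) (u + t • x) * x i) t := by
  have h1 : HasDerivAt (fun t : ℝ => u + t • x) x t := by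
    simpa using ((hasDerivAt_id t).smul_const x).const_add u
  have := (ev_fderiv d P (u + t • x)).comp_hasDerivAt t h1
  exact this.congr_deriv (by simp)

theorem ev_hasFDerivAt' (d : ℕ) (P : MvPolynomial (Fin (d+1)) ℝ) (u x : Esp d) (t : ℝ) :
    HasFDerivAt (fun x : Esp d => ev d P (u + t • x))
     (t • ∑ i, ev d (pderiv i P) (u + t • x) • (EuclideanSpace.proj i : Esp d →L[ℝ] ℝ)) x := by
  have h1 : HasFDerivAt (fun x : Esp d => u + t • x) (t • ContinuousLinearMap.id ℝ (Esp d)) x := by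
    simpa using ((hasFDerivAt_id x).const_smul t).const_add u
  have := (ev_fderiv d P (u + t • x)).comp x h1
  refine this.congr_fderiv ?_
  ext v; simp

theorem maxsq_deriv (y : ℝ) : HasDerivAt (fun y : ℝ => (max 0 y)^2) (2 * max 0 y) y := by
  rcases lt_trichotomy y 0 with h | h | h
  · rw [max_eq_left h.le]
    refine (hasDerivAt_const y (0:ℝ)).congr_of_eventuallyEq ?_ |>.congr_deriv (by simp)
    filter_upwards [Iio_mem_nhds h] with z hz
    simp [max_eq_left (le_of_lt (Set.mem_Iio.1 hz))]
  · subst h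
    rw [hasDerivAt_iff_isLittleO]
    simp only [max_self, mul_zero, smul_zero, sub_zero]
    have h2 : (fun z : ℝ => z ^ 2) =o[nhds 0] (fun z : ℝ => z) := by
      simpa using Asymptotics.isLittleO_pow_id (𝕜 := ℝ) (n := 2) (by norm_num)
    refine (Asymptotics.IsBigO.of_bound 1 ?_).trans_isLittleO h2
    filter_upwards with z
    have : |max 0 z| ≤ |z| := by
      rw [abs_of_nonneg (le_max_left _ _)]
      exact max_le (abs_nonneg _) (le_abs_self _)
    simp only [ne_eq, OfNat.ofNat_ne_zero, not_false_eq_true, zero_pow, sub_zero, norm_pow,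
      Real.norm_eq_abs, one_mul]
    gcongr
  · rw [max_eq_right h.le]
    refine ((hasDerivAt_id y).pow 2).congr_of_eventuallyEq ?_ |>.congr_deriv (by simp)
    filter_upwards [Ioi_mem_nhds h] with z hz
    simp [max_eq_right (le_of_lt (Set.mem_Ioi.1 hz))]

/-- weight -/
def wt (d : ℕ) (x : Esp d) : ℝ := max 0 (1 - ‖x‖^2)

theorem wt_cont (d : ℕ) : Continuous (wt d) := by unfold wt; fun_prop

theorem wt_nonneg (d : ℕ) (x : Esp d) : 0 ≤ wt d x := le_max_left _ _

theorem wt_le (d : ℕ) (x : Esp d) : wt d x ≤ 1 :=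
  max_le zero_le_one (by nlinarith [norm_nonneg x])

theorem wt_zero (d : ℕ) (x : Esp d) (hx : 1 ≤ ‖x‖) : wt d x = 0 :=
  max_eq_left (by nlinarith [norm_nonneg x])

theorem wt_supp (d : ℕ) : HasCompactSupport (wt d) := by
  refine HasCompactSupport.intro (isCompact_closedBall (0 : Esp d) 1) ?_
  intro x hx
  apply wt_zero
  simp only [Metric.mem_closedBall, dist_zero_right, not_le] at hx
  exact hx.le

theorem wt_int (d : ℕ) (f : Esp d → ℝ) (hf : Continuous f) :
    Integrable (fun x => f x * wt d x) :=
  (hf.mul (wt_cont d)).integrable_of_hasCompactSupport ((wt_supp d).mul_left)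

theorem wt2_int (d : ℕ) (f : Esp d → ℝ) (hf : Continuous f) :
    Integrable (fun x => f x * (wt d x)^2) := by
  have := wt_int d (fun x => f x * wt d x) (hf.mul (wt_cont d))
  refine this.congr ?_
  filter_upwards with x; ring

theorem wt_pos (d : ℕ) : 0 < ∫ x, wt d x := by
  apply (wt_cont d).integral_pos_of_hasCompactSupport_nonneg_nonzero (wt_supp d) (wt_nonneg d)
    (x := 0)
  simp [wt]

theorem wt2_fderiv (d : ℕ) (x : Esp d) :
    HasFDerivAt (fun x => (wt d x)^2) ((-4 * wt d x) • (innerSL ℝ x : Esp d →L[ℝ] ℝ)) x := by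
  have h1 : HasFDerivAt (fun x : Esp d => 1 - ‖x‖^2) (-(2 • (innerSL ℝ x : Esp d →L[ℝ] ℝ))) x :=
    (hasStrictFDerivAt_norm_sq x).hasFDerivAt.const_sub 1
  have := (maxsq_deriv (1 - ‖x‖^2)).comp_hasFDerivAt x h1
  refine this.congr_fderiv ?_
  ext v
  simp [wt]; ring

theorem ibp (d : ℕ) (P : MvPolynomial (Fin (d+1)) ℝ) (u : Esp d) (t : ℝ) (i : Fin (d+1)) :
    4 * ∫ x, ev d P (u + t • x) * x i * wt d x =
      t * ∫ x, ev d (pderiv i P) (u + t • x) * (wt d x)^2 := by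
  have hc : ∀ Q, Continuous (fun x : Esp d => ev d Q (u + t • x)) := fun Q =>
    (ev_cont d Q).comp (by fun_prop)
  have hf : ∀ x, fderiv ℝ (fun x : Esp d => ev d P (u + t • x)) x (EuclideanSpace.single i 1)
      = t * ev d (pderiv i P) (u + t • x) := by
    intro x
    rw [(ev_hasFDerivAt' d P u x t).fderiv]
    simp [Pi.single_apply]
  have hg : ∀ x, fderiv ℝ (fun x : Esp d => (wt d x)^2) x (EuclideanSpace.single i 1)
      = -4 * wt d x * x i := by
    intro x
    rw [(wt2_fderiv d x).fderiv]
    simp [EuclideanSpace.inner_single_right]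
  have key := integral_mul_fderiv_eq_neg_fderiv_mul_of_integrable (𝕜 := ℝ)
    (μ := (volume : Measure (Esp d)))
    (f := fun x : Esp d => ev d P (u + t • x)) (g := fun x : Esp d => (wt d x)^2)
    (v := EuclideanSpace.single i 1) ?_ ?_ ?_ ?_ ?_
  · simp only [hf, hg] at key
    have e1 : ∫ x, ev d P (u + t • x) * (-4 * wt d x * x i) =
      -4 * ∫ x, ev d P (u + t • x) * x i * wt d x := by
      rw [← integral_const_mul]; congr 1; ext x; ring
    have e2 : ∫ x, t * ev d (pderiv i P) (u + t • x) * (wt d x)^2 =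
      t * ∫ x, ev d (pderiv i P) (u + t • x) * (wt d x)^2 := by
      rw [← integral_const_mul]; congr 1; ext x; ring
    rw [e1, e2] at key
    linarith
  · simp only [hf]
    exact wt2_int d _ ((hc _).const_mul t)
  · simp only [hg]
    refine (wt_int d (fun x => ev d P (u + t • x) * (-4 * x i)) ((hc _).mul (by fun_prop))).congr ?_
    filter_upwards with x; ring
  · exact wt2_int d _ (hc _)
  · exact fun x _ => (ev_hasFDerivAt' d P u x t).differentiableAt
  · exact fun x _ => (wt2_fderiv d x).differentiableAt

theorem mvp (d : ℕ) (P : MvPolynomial (Fin (d+1)) ℝ) (hP : polyLap d P = 0) (u : Esp d) (t : ℝ) :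
    ∫ x, ev d P (u + t • x) * wt d x = ev d P u * ∫ x, wt d x := by
  have hc : ∀ Q, Continuous (fun z : ℝ × Esp d => ev d Q (u + z.1 • z.2)) := fun Q =>
    (ev_cont d Q).comp (by fun_prop)
  have hder : ∀ t : ℝ, HasDerivAt (fun t : ℝ => ∫ x, ev d P (u + t • x) * wt d x) 0 t := by
    intro t
    let F' : ℝ → Esp d → ℝ := fun t x => (∑ i, ev d (pderiv i P) (u + t • x) * x i) * wt d x
    have hF'c : Continuous (fun z : ℝ × Esp d => F' z.1 z.2) := by
      refine Continuous.mul ?_ ((wt_cont d).comp continuous_snd)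
      refine continuous_finsetSum _ fun i _ => (hc _).mul (by fun_prop)
    obtain ⟨K, hK⟩ := ((isCompact_closedBall t 1).prod
      (isCompact_closedBall (0 : Esp d) 1)).exists_bound_of_continuousOn hF'c.continuousOn
    have := hasDerivAt_integral_of_dominated_loc_of_deriv_le (𝕜 := ℝ)
      (μ := (volume : Measure (Esp d)))
      (F := fun t x => ev d P (u + t • x) * wt d x) (F' := F') (x₀ := t)
      (bound := fun x => (Metric.closedBall (0 : Esp d) 1).indicator (fun _ => K) x)
      (s := Metric.ball t 1) (Metric.ball_mem_nhds t one_pos) ?_ ?_ ?_ ?_ ?_ ?_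
    · refine this.2.congr_deriv ?_
      have : ∀ x, F' t x = ∑ i, ev d (pderiv i P) (u + t • x) * x i * wt d x := by
        intro x; simp [F', Finset.sum_mul]
      rw [funext this, integral_finsetSum]
      · have h4 : 4 * ∑ i, ∫ x, ev d (pderiv i P) (u + t • x) * x i * wt d x = 0 := by
          rw [Finset.mul_sum]
          simp only [ibp]
          rw [← Finset.mul_sum, ← integral_finsetSum]
          · have : ∀ x : Esp d, ∑ i, ev d (pderiv i (pderiv i P)) (u + t • x) * wt d x ^ 2 = 0 := by
              intro x
              rw [← Finset.sum_mul]
              have : ∑ i, ev d (pderiv i (pderiv i P)) (u + t • x)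
                = ev d (polyLap d P) (u + t • x) := by
                simp [ev, polyLap]
              rw [this, hP]; simp [ev]
            simp [this]
          · intro i _
            exact wt2_int d _ ((ev_cont d _).comp (by fun_prop))
        linarith
      · intro i _
        exact wt_int d _ (((ev_cont d _).comp (by fun_prop)).mul (by fun_prop))
    · filter_upwards with s
      exact (((ev_cont d _).comp (by fun_prop)).mul (wt_cont d)).aestronglyMeasurable
    · exact wt_int d _ ((ev_cont d _).comp (by fun_prop))
    · exact (hF'c.comp (by fun_prop : Continuous fun x : Esp d => (t, x))).aestronglyMeasurable
    · filter_upwards with x s hs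
      by_cases hx : x ∈ Metric.closedBall (0 : Esp d) 1
      · simp only [Set.indicator_of_mem hx]
        exact hK (s, x) ⟨Metric.ball_subset_closedBall hs, hx⟩
      · simp only [Set.indicator_of_notMem hx]
        simp only [Metric.mem_closedBall, dist_zero_right, not_le] at hx
        simp [F', wt_zero d x hx.le]
    · rw [integrable_indicator_iff Metric.isClosed_closedBall.measurableSet]
      exact integrableOn_const (isCompact_closedBall _ _).measure_lt_top.ne
    · filter_upwards with x s hs
      exact (ev_hasDerivAt d P u x s).mul_const _
  have := is_const_of_deriv_eq_zero (fun t => (hder t).differentiableAt) (fun t => (hder t).deriv) t 0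
  rw [this]
  simp [integral_const_mul]

theorem tangent (p : ℝ) (hp : 1 ≤ p) (a s : ℝ) (ha : 0 < a) (hs : 0 ≤ s) :
    a ^ p + p * a ^ (p - 1) * (s - a) ≤ s ^ p := by
  have h := one_add_mul_self_le_rpow_one_add (s := s / a - 1)
    (by have : 0 ≤ s / a := by positivity
        linarith) hp
  have e : 1 + (s / a - 1) = s / a := by ring
  rw [e, Real.div_rpow hs ha.le, le_div_iff₀ (Real.rpow_pos_of_pos ha p)] at h
  refine le_trans (le_of_eq ?_) h
  have : a ^ p = a ^ (p - 1) * a := by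
    rw [← Real.rpow_add_one ha.ne']; congr 1; ring
  rw [this]; field_simp

theorem part1 (d : ℕ) (p : ℝ) (hp : 1 ≤ p) (P : MvPolynomial (Fin (d+1)) ℝ)
    (hP : polyLap d P = 0) (u : Esp d) (L : ℕ) (hL : 1 ≤ L) :
    |ev d P u| ^ p ≤ (∫ x, wt d x)⁻¹ * (L : ℝ)^(d+1) *
      ∫ x in Metric.ball u (1 / L), |ev d P x| ^ p := by
  have hL0 : (0:ℝ) < L := by exact_mod_cast hL
  set t : ℝ := 1 / L with ht
  have ht0 : 0 < t := by positivity
  have hp0 : 0 ≤ p := by linarith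
  have hcont : Continuous (fun x => |ev d P x| ^ p) :=
    (ev_cont d P).abs.rpow_const (fun _ => Or.inr hp0)
  have hpos := wt_pos d
  -- step 1
  have s1 : |ev d P u| ^ p * ∫ x, wt d x ≤ ∫ x, |ev d P (u + t • x)| ^ p * wt d x := by
    rcases eq_or_ne (ev d P u) 0 with h0 | h0
    · rw [h0, abs_zero, Real.zero_rpow (by linarith), zero_mul]
      exact integral_nonneg fun x => mul_nonneg (by positivity) (wt_nonneg d x)
    · have ha : 0 < |ev d P u| := abs_pos.2 h0
      set a := |ev d P u| with had
      have hcu : Continuous (fun x : Esp d => |ev d P (u + t • x)|) :=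
        ((ev_cont d P).comp (by fun_prop)).abs
      have hcw := wt_int d (fun _ => 1) continuous_const
      simp only [one_mul] at hcw
      have m1 : a * ∫ x, wt d x ≤ ∫ x, |ev d P (u + t • x)| * wt d x := by
        have := mvp d P hP u t
        have h2 := abs_integral_le_integral_abs (f := fun x => ev d P (u + t • x) * wt d x)
          (μ := volume)
        rw [this, abs_mul, abs_of_pos hpos] at h2
        simpa [abs_mul, abs_of_nonneg (wt_nonneg d _)] using h2
      have m2 : ∫ x, (a ^ p * wt d x + p * a ^ (p - 1) * (|ev d P (u + t • x)| * wt d x - a * wt d x))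
          ≤ ∫ x, |ev d P (u + t • x)| ^ p * wt d x := by
        refine integral_mono ?_ ?_ ?_
        · exact (hcw.const_mul _).add (((wt_int d _ hcu).sub (hcw.const_mul _)).const_mul _)
        · exact wt_int d _ (hcu.rpow_const (fun _ => Or.inr hp0))
        · intro x
          have := mul_le_mul_of_nonneg_right
            (tangent p hp a (|ev d P (u + t • x)|) ha (abs_nonneg _)) (wt_nonneg d x)
          simp only
          linarith
      rw [integral_add, integral_const_mul, integral_const_mul, integral_sub, integral_const_mul]
        at m2
      · have : 0 ≤ p * a ^ (p - 1) := by positivity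
        nlinarith
      · exact wt_int d _ hcu
      · exact hcw.const_mul _
      · exact hcw.const_mul _
      · exact ((wt_int d _ hcu).sub (hcw.const_mul _)).const_mul _
  -- step 2
  have s2 : ∫ x, |ev d P (u + t • x)| ^ p * wt d x ≤
      (L:ℝ)^(d+1) * ∫ x in Metric.ball u t, |ev d P x| ^ p := by
    set G : Esp d → ℝ := (Metric.ball u t).indicator (fun x => |ev d P x| ^ p) with hG
    have hGi : Integrable G := by
      rw [hG, integrable_indicator_iff measurableSet_ball]
      exact (hcont.continuousOn.integrableOn_compact (isCompact_closedBall u t)).mono_set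
        Metric.ball_subset_closedBall
    have hGi' : Integrable (fun x => G (u + x)) := hGi.comp_add_left u
    have e1 : ∫ x : Esp d, G (u + t • x) = (L:ℝ)^(d+1) * ∫ x, G x := by
      have := Measure.integral_comp_smul (volume : Measure (Esp d)) (fun x => G (u + x)) t
      rw [this, integral_add_left_eq_self G u]
      simp [ht]
    rw [← integral_indicator measurableSet_ball, ← hG, ← e1]
    refine integral_mono (wt_int d _ (hcont.comp (by fun_prop))) ?_ ?_
    · exact hGi'.comp_smul ht0.ne'
    · intro x
      simp only [hG]
      by_cases hx : 1 ≤ ‖x‖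
      · rw [wt_zero d x hx, mul_zero]
        exact Set.indicator_nonneg (fun _ _ => by positivity) _
      · rw [Set.indicator_of_mem]
        · exact mul_le_of_le_one_right (by positivity) (wt_le d x)
        · simp only [Metric.mem_ball, dist_self_add_left, norm_smul, Real.norm_eq_abs,
            abs_of_pos ht0]
          nlinarith
  have := s1.trans s2
  rw [← le_div_iff₀ hpos] at this
  refine this.trans (le_of_eq ?_)
  ring
/-- coordinate functions on the sphere -/
def coordF (d : ℕ) (i : Fin (d+1)) : C(Sph d, ℝ) := ⟨fun x => (x : Esp d) i, by fun_prop⟩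

/-- affine functions on the sphere -/
def A1 (d : ℕ) : Submodule ℝ C(Sph d, ℝ) :=
  Submodule.span ℝ ({1} ∪ Set.range (coordF d))

theorem one_mem_A1 (d : ℕ) : (1 : C(Sph d, ℝ)) ∈ A1 d :=
  Submodule.subset_span (Or.inl rfl)

theorem coordF_mem_A1 (d : ℕ) (i) : coordF d i ∈ A1 d :=
  Submodule.subset_span (Or.inr ⟨i, rfl⟩)

theorem A1_pow_mono (d : ℕ) {m n : ℕ} (h : m ≤ n) : A1 d ^ m ≤ A1 d ^ n := by
  have h1 : (1 : Submodule ℝ C(Sph d, ℝ)) ≤ A1 d := by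
    rw [Submodule.one_le]; exact one_mem_A1 d
  exact pow_le_pow_right' h1 h

theorem coordF_rel (d : ℕ) : coordF d 0 * coordF d 0 =
    1 - ∑ i : Fin d, coordF d i.succ * coordF d i.succ := by
  ext x
  have hx : ‖(x : Esp d)‖ = 1 := mem_sphere_zero_iff_norm.1 x.2
  have h2 := EuclideanSpace.norm_sq_eq (x : Esp d)
  rw [hx, Fin.sum_univ_succ] at h2
  simp only [Real.norm_eq_abs, sq_abs] at h2
  simp [coordF, ContinuousMap.sum_apply]
  simp only [← pow_two]
  linarith

/-- reduced monomials -/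
def monoF (d : ℕ) (a : ℕ) (β : Fin d → ℕ) : C(Sph d, ℝ) :=
  coordF d 0 ^ a * ∏ i : Fin d, coordF d i.succ ^ β i

/-- set of reduced monomials -/
def MSet (d N : ℕ) : Set C(Sph d, ℝ) :=
  {f | ∃ (a : ℕ) (β : Fin d → ℕ), a ≤ 1 ∧ (∀ i, a + β i ≤ N) ∧ f = monoF d a β}

theorem monoF_mul_succ (d a : ℕ) (β : Fin d → ℕ) (i : Fin d) :
    monoF d a β * coordF d i.succ = monoF d a (β + Pi.single i 1) := by
  unfold monoF
  simp only [Pi.add_apply, pow_add, Finset.prod_mul_distrib]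
  have : ∏ j : Fin d, coordF d j.succ ^ (Pi.single i 1 : Fin d → ℕ) j = coordF d i.succ := by
    rw [Finset.prod_eq_single i]
    · simp
    · intro b _ hb; simp [Pi.single_eq_of_ne hb]
    · simp
  rw [this]; ring

theorem monoF_mul_zero (d a : ℕ) (β : Fin d → ℕ) :
    monoF d a β * coordF d 0 = monoF d (a+1) β := by
  unfold monoF; ring

theorem A1_pow_le (d N : ℕ) : A1 d ^ N ≤ Submodule.span ℝ (MSet d N) := by
  induction N with
  | zero =>
    rw [pow_zero, Submodule.one_le]
    apply Submodule.subset_span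
    exact ⟨0, 0, by simp, by simp, by simp [monoF]⟩
  | succ N ih =>
    rw [pow_succ]
    refine (mul_le_mul' ih le_rfl).trans ?_
    rw [A1, Submodule.span_mul_span, Submodule.span_le]
    rintro _ ⟨f, ⟨a, β, ha, hβ, rfl⟩, g, hg, rfl⟩
    simp only [SetLike.mem_coe]
    rcases hg with rfl | ⟨i, rfl⟩
    · apply Submodule.subset_span
      exact ⟨a, β, ha, fun i => (hβ i).trans (Nat.le_succ N), by simp⟩
    · refine Fin.cases ?_ (fun i => ?_) i
      · interval_cases a
        · apply Submodule.subset_span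
          exact ⟨1, β, le_rfl, fun i => by have := hβ i; omega, monoF_mul_zero d 0 β⟩
        · have e : monoF d 1 β * coordF d 0 = monoF d 0 β -
              ∑ i : Fin d, monoF d 0 ((β + Pi.single i 1) + Pi.single i 1) := by
            have : monoF d 1 β = monoF d 0 β * coordF d 0 := (monoF_mul_zero d 0 β).symm
            rw [this, mul_assoc, coordF_rel, mul_sub, mul_one, Finset.mul_sum]
            simp only [← monoF_mul_succ, mul_assoc]
          simp only [e]
          refine Submodule.sub_mem _ (Submodule.subset_span ?_)
            (Submodule.sum_mem _ fun i _ => Submodule.subset_span ?_)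
          · exact ⟨0, β, by simp, fun i => by have := hβ i; omega, rfl⟩
          · refine ⟨0, _, by simp, fun j => ?_, rfl⟩
            have := hβ j
            by_cases hj : j = i
            · subst hj; simp; omega
            · simp [Pi.single_eq_of_ne hj]; omega
      · apply Submodule.subset_span
        refine ⟨a, _, ha, fun j => ?_, monoF_mul_succ d a β i⟩
        have := hβ j
        by_cases hj : j = i
        · subst hj; simp; omega
        · simp [Pi.single_eq_of_ne hj]; omega

/-- parametrisation of reduced monomials -/
def monoP (d N : ℕ) (q : Fin 2 × (Fin d → Fin (N+1))) : C(Sph d, ℝ) :=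
  monoF d q.1 (fun i => q.2 i)

theorem A1_pow_le' (d N : ℕ) : A1 d ^ N ≤ Submodule.span ℝ (Set.range (monoP d N)) := by
  refine (A1_pow_le d N).trans (Submodule.span_mono ?_)
  rintro _ ⟨a, β, ha, hβ, rfl⟩
  exact ⟨(⟨a, by omega⟩, fun i => ⟨β i, by have := hβ i; omega⟩), rfl⟩

theorem A1_fin (d N : ℕ) : FiniteDimensional ℝ ↥(A1 d ^ N) := by
  have : FiniteDimensional ℝ (Submodule.span ℝ (Set.range (monoP d N))) :=
    FiniteDimensional.span_of_finite ℝ (Set.finite_range _)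
  exact Submodule.finiteDimensional_of_le (A1_pow_le' d N)

theorem A1_finrank (d N : ℕ) : Module.finrank ℝ ↥(A1 d ^ N) ≤ 2 * (N+1)^d := by
  have : FiniteDimensional ℝ (Submodule.span ℝ (Set.range (monoP d N))) :=
    FiniteDimensional.span_of_finite ℝ (Set.finite_range _)
  refine (Submodule.finrank_mono (A1_pow_le' d N)).trans ?_
  refine (finrank_range_le_card (R := ℝ) (monoP d N)).trans ?_
  simp

theorem prod_mem_A1 (d : ℕ) (s : Fin (d+1) → ℕ) (T : Finset (Fin (d+1))) :
    ∏ i ∈ T, coordF d i ^ s i ∈ A1 d ^ (∑ i ∈ T, s i) := by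
  induction T using Finset.induction_on with
  | empty => simp [Submodule.one_le.1 le_rfl]
  | insert a T ha ih =>
    rw [Finset.prod_insert ha, Finset.sum_insert ha, pow_add]
    exact Submodule.mul_mem_mul (Submodule.pow_mem_pow _ (coordF_mem_A1 d a) _) ih

theorem aeval_mem (d L : ℕ) (P : MvPolynomial (Fin (d+1)) ℝ) (hP : P ∈ harmPolyLe d L) :
    aeval (coordF d) P ∈ A1 d ^ L := by
  have : harmPolyLe d L ≤ (A1 d ^ L).comap (aeval (coordF d)).toLinearMap := by
    refine iSup_le fun ℓ => ?_
    rintro Q ⟨hQ, -⟩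
    have hQ' : Q.IsHomogeneous ℓ := hQ
    rw [Submodule.mem_comap, AlgHom.toLinearMap_apply, aeval_def, eval₂_eq']
    refine Submodule.sum_mem _ fun s hs => ?_
    rw [← Algebra.smul_def]
    refine Submodule.smul_mem _ _ (A1_pow_mono d ?_ (prod_mem_A1 d s Finset.univ))
    have h1 := hQ' (mem_support_iff.1 hs)
    have h2 : ∑ i, s i = s.degree := (Finsupp.degree_eq_sum s).symm
    have h3 : s.degree = ℓ := by
      rw [← h1, Finsupp.degree_eq_weight_one]; rfl
    have := ℓ.2
    omega
  exact this hP

theorem aeval_apply' (d : ℕ) (P : MvPolynomial (Fin (d+1)) ℝ) (x : Sph d) :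
    aeval (coordF d) P x = eval (fun i => (x : Esp d) i) P := by
  rw [aeval_def, eval₂_eq', eval_eq', ContinuousMap.sum_apply]
  simp [coordF, ContinuousMap.prod_apply]

theorem harm_lap (d L : ℕ) (P : MvPolynomial (Fin (d+1)) ℝ) (hP : P ∈ harmPolyLe d L) :
    polyLap d P = 0 := by
  have : harmPolyLe d L ≤ LinearMap.ker (polyLap d) :=
    iSup_le fun ℓ => inf_le_right
  exact this hP

/-- isometry acting on the sphere -/
def gS (d : ℕ) (g : Esp d ≃ₗᵢ[ℝ] Esp d) : C(Sph d, Sph d) :=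
  ⟨fun x => ⟨g x, by simp⟩, by fun_prop⟩

theorem gS_mp (d : ℕ) (g : Esp d ≃ₗᵢ[ℝ] Esp d) :
    MeasurePreserving (gS d g) (sphMeasure d) (sphMeasure d) := by
  refine ⟨(gS d g).continuous.measurable, ?_⟩
  ext s hs
  rw [Measure.map_apply (gS d g).continuous.measurable hs]
  unfold sphMeasure
  rw [Measure.toSphere_apply' _ hs, Measure.toSphere_apply' _ ((gS d g).continuous.measurable hs)]
  congr 1
  conv_rhs =>
    rw [← g.measurePreserving.measure_preimage_emb g.toHomeomorph.measurableEmbedding]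
  congr 1
  ext x
  simp only [Set.mem_smul, Set.mem_image, Set.mem_preimage]
  constructor
  · rintro ⟨r, hr, _, ⟨y, hy, rfl⟩, rfl⟩
    exact ⟨r, hr, _, ⟨gS d g y, hy, rfl⟩, by simp [gS]⟩
  · rintro ⟨r, hr, _, ⟨y, hy, rfl⟩, h⟩
    refine ⟨r, hr, _, ⟨gS d g.symm y, ?_, rfl⟩, ?_⟩
    · have : gS d g (gS d g.symm y) = y := by ext1; simp [gS]
      rwa [this]
    · apply g.injective
      simp [gS, h]

theorem gS_int (d : ℕ) (g : Esp d ≃ₗᵢ[ℝ] Esp d) (f : C(Sph d, ℝ)) :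
    ∫ x, f (gS d g x) ∂(sphMeasure d) = ∫ x, f x ∂(sphMeasure d) := by
  have h := (gS_mp d g).map_eq
  conv_rhs => rw [← h]
  rw [integral_map (gS d g).continuous.aemeasurable f.continuous.aestronglyMeasurable]

theorem gS_mem (d N : ℕ) (g : Esp d ≃ₗᵢ[ℝ] Esp d) (f : C(Sph d, ℝ)) (hf : f ∈ A1 d ^ N) :
    f.comp (gS d g) ∈ A1 d ^ N := by
  have h1 : (A1 d).map (ContinuousMap.compRightAlgHom ℝ ℝ (gS d g)).toLinearMap ≤ A1 d := by
    rw [A1, Submodule.map_span, Submodule.span_le]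
    rintro _ ⟨h, hh, rfl⟩
    rcases hh with rfl | ⟨i, rfl⟩
    · rw [AlgHom.toLinearMap_apply, map_one]
      exact one_mem_A1 d
    · have : (ContinuousMap.compRightAlgHom ℝ ℝ (gS d g)).toLinearMap (coordF d i)
          = ∑ j, (g (EuclideanSpace.single j 1) i) • coordF d j := by
        ext x
        have hx : (x : Esp d) = ∑ j, (x : Esp d) j • EuclideanSpace.single j (1:ℝ) := by
          have := (EuclideanSpace.basisFun (Fin (d+1)) ℝ).sum_repr (x : Esp d)
          simpa using this.symm
        have h3 : g (x : Esp d) i = ∑ j, (x : Esp d) j * g (EuclideanSpace.single j (1:ℝ)) i := by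
          conv_lhs => rw [hx]
          simp [map_sum]
        simp only [ContinuousMap.sum_apply, ContinuousMap.smul_apply, smul_eq_mul]
        change g (x : Esp d) i = _
        rw [h3]
        exact Finset.sum_congr rfl fun j _ => mul_comm _ _
      rw [this]
      exact Submodule.sum_mem _ fun j _ => Submodule.smul_mem _ _ (coordF_mem_A1 d j)
  have h2 : (A1 d ^ N).map (ContinuousMap.compRightAlgHom ℝ ℝ (gS d g)).toLinearMap ≤ A1 d ^ N := by
    rw [Submodule.map_pow]
    exact pow_le_pow_left' h1 N
  exact h2 ⟨f, hf, rfl⟩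

theorem exists_g (d : ℕ) (u v : Sph d) : ∃ g, gS d g u = v := by
  have h : ‖(u : Esp d)‖ = ‖(v : Esp d)‖ := by simp
  refine ⟨Submodule.reflection (Submodule.span ℝ {(u : Esp d) - v})ᗮ, ?_⟩
  ext1
  exact Submodule.reflection_sub h

theorem sph_pos (d : ℕ) : 0 < (sphMeasure d).real Set.univ := by
  have : sphMeasure d ≠ 0 := by unfold sphMeasure; exact Measure.toSphere_ne_zero _
  have : NeZero (sphMeasure d) := ⟨this⟩
  exact measureReal_univ_pos

theorem nik2 (d N : ℕ) (R : C(Sph d, ℝ)) (hR : R ∈ A1 d ^ N) (u : Sph d) :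
    (R u)^2 * (sphMeasure d).real Set.univ ≤
      (2 * (N+1)^d : ℕ) * ∫ x, (R x)^2 ∂(sphMeasure d) := by
  set μ := sphMeasure d with hμ
  let T : C(Sph d, ℝ) →L[ℝ] Lp ℝ 2 μ := ContinuousMap.toLp 2 μ ℝ
  have hT : Function.Injective T := ContinuousMap.toLp_injective μ
  have hTi : ∀ f g : C(Sph d, ℝ), inner ℝ (T f) (T g) = ∫ x, f x * g x ∂μ := by
    intro f g
    rw [ContinuousMap.inner_toLp]
    simp [mul_comm]
  have hfin := A1_fin d N
  let W : Submodule ℝ (Lp ℝ 2 μ) := (A1 d ^ N).map T.toLinearMap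
  have hWle : Module.finrank ℝ W ≤ 2 * (N+1)^d :=
    (Submodule.finrank_map_le T.toLinearMap (A1 d ^ N)).trans (A1_finrank d N)
  let b := stdOrthonormalBasis ℝ W
  have hb : ∀ i, ∃ f ∈ A1 d ^ N, T f = (b i : Lp ℝ 2 μ) := fun i => (b i).2
  choose f hf hfb using hb
  have horth : ∀ i j, ∫ x, f i x * f j x ∂μ = if i = j then 1 else 0 := by
    intro i j
    rw [← hTi, hfb, hfb, ← Submodule.coe_inner]
    exact orthonormal_iff_ite.1 b.orthonormal i j
  let K : Sph d → ℝ := fun u => ∑ i, (f i u)^2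
  have hK0 : ∀ u, 0 ≤ K u := fun u => Finset.sum_nonneg fun i _ => sq_nonneg _
  -- pointwise bound
  have hbound : ∀ R ∈ A1 d ^ N, ∀ u, (R u)^2 ≤ K u * ∫ x, (R x)^2 ∂μ := by
    intro R hR u
    let w : W := ⟨T R, ⟨R, hR, rfl⟩⟩
    have h1 : ∑ i, b.repr w i • b i = w := b.sum_repr w
    have h2 : R = ∑ i, b.repr w i • f i := by
      apply hT
      have := congrArg (fun z : W => (z : Lp ℝ 2 μ)) h1
      simp only [Submodule.coe_sum, Submodule.coe_smul] at this
      rw [map_sum]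
      simp only [map_smul, hfb]
      exact this.symm
    have h3 : ∑ i, (b.repr w i)^2 = ∫ x, (R x)^2 ∂μ := by
      have e1 : ‖b.repr w‖^2 = ‖w‖^2 := by rw [LinearIsometryEquiv.norm_map]
      rw [EuclideanSpace.norm_sq_eq] at e1
      simp only [Real.norm_eq_abs, sq_abs] at e1
      rw [e1, ← real_inner_self_eq_norm_sq, Submodule.coe_inner]
      change inner ℝ (T R) (T R) = _
      rw [hTi]; simp [pow_two]
    have h4 : R u = ∑ i, f i u * b.repr w i := by
      conv_lhs => rw [h2]
      simp [ContinuousMap.sum_apply, mul_comm]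
    rw [← h3, h4]
    exact Finset.sum_mul_sq_le_sq_mul_sq _ _ _
  have hint : ∀ f : C(Sph d, ℝ), Integrable (fun x => f x) μ := fun f =>
    f.continuous.integrable_of_hasCompactSupport (HasCompactSupport.of_compactSpace _)
  have hint2 : ∀ f g : C(Sph d, ℝ), Integrable (fun x => f x * g x) μ := fun f g => hint (f * g)
  have hint3 : ∀ f : C(Sph d, ℝ), Integrable (fun x => f x ^ 2) μ := fun f => hint (f ^ 2)
  -- K constant
  have hKle : ∀ u v, K u ≤ K v := by
    intro u v
    obtain ⟨g, hg⟩ := exists_g d v u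
    let S : C(Sph d, ℝ) := ∑ i, f i u • f i
    have hS : S ∈ A1 d ^ N := Submodule.sum_mem _ fun i _ => Submodule.smul_mem _ _ (hf i)
    have hSu : S u = K u := by
      simp [S, K, ContinuousMap.sum_apply, pow_two]
    have hSi : ∫ x, (S x)^2 ∂μ = K u := by
      have : ∀ x, (S x)^2 = ∑ i, ∑ j, (f i u * f j u) * (f i x * f j x) := by
        intro x
        simp only [S, ContinuousMap.sum_apply, ContinuousMap.smul_apply, smul_eq_mul, pow_two,
          Finset.sum_mul_sum]
        refine Finset.sum_congr rfl fun i _ => Finset.sum_congr rfl fun j _ => by ring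
      simp only [this]
      rw [integral_finsetSum _ (fun i _ => integrable_finsetSum _
        fun j _ => (hint2 (f i) (f j)).const_mul _)]
      have : ∀ i, ∫ x, ∑ j, (f i u * f j u) * (f i x * f j x) ∂μ = (f i u)^2 := by
        intro i
        rw [integral_finsetSum _ (fun j _ => (hint2 (f i) (f j)).const_mul _)]
        simp only [integral_const_mul, horth]
        simp [pow_two]
      simp [this, K]
    have h5 := hbound _ (gS_mem d N g S hS) v
    have h6 : ∫ x, ((S.comp (gS d g)) x)^2 ∂μ = ∫ x, (S x)^2 ∂μ := gS_int d g (S^2)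
    rw [h6, hSi, ContinuousMap.comp_apply, hg, hSu] at h5
    rcases (hK0 u).eq_or_lt with h0 | h0
    · rw [← h0]; exact hK0 v
    · nlinarith
  have hKint : ∫ x, K x ∂μ = Module.finrank ℝ W := by
    simp only [K]
    rw [integral_finsetSum _ (fun i _ => hint3 (f i))]
    have : ∀ i, ∫ x, (f i x)^2 ∂μ = 1 := by
      intro i
      have := horth i i
      simpa [pow_two] using this
    simp [this]
  have hKu : K u * μ.real Set.univ ≤ (2 * (N+1)^d : ℕ) := by
    have : ∫ _x, K u ∂μ ≤ ∫ x, K x ∂μ := by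
      refine integral_mono (integrable_const _) ?_ (fun v => hKle u v)
      exact integrable_finsetSum _ (fun i _ => hint3 (f i))
    rw [hKint, integral_const, smul_eq_mul, mul_comm] at this
    exact this.trans (by exact_mod_cast hWle)
  have hI : 0 ≤ ∫ x, (R x)^2 ∂μ := integral_nonneg fun x => sq_nonneg _
  calc (R u)^2 * μ.real Set.univ ≤ (K u * ∫ x, (R x)^2 ∂μ) * μ.real Set.univ := by
        gcongr; exact hbound R hR u
    _ = (K u * μ.real Set.univ) * ∫ x, (R x)^2 ∂μ := by ring
    _ ≤ _ := by gcongr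

theorem part2 (d : ℕ) (p : ℝ) (hp : 1 ≤ p) (L : ℕ) (hL : 1 ≤ L) (R : C(Sph d, ℝ))
    (hR : R ∈ A1 d ^ L) (u : Sph d) :
    |R u| ^ p ≤ (2 * (2 * (⌈p⌉₊ : ℝ))^d / (sphMeasure d).real Set.univ) * (L : ℝ)^d *
      ∫ x, |R x| ^ p ∂(sphMeasure d) := by
  set k := ⌈p⌉₊ with hk
  have hpk : p ≤ k := Nat.le_ceil p
  have hk1 : 1 ≤ k := by
    have : (1:ℝ) ≤ k := hp.trans hpk
    exact_mod_cast this
  have hp0 : 0 ≤ p := by linarith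
  set μ := sphMeasure d with hμ
  have hμ0 := sph_pos d
  obtain ⟨u0, -, hu0⟩ := isCompact_univ.exists_isMaxOn (⟨u, trivial⟩ : (Set.univ : Set (Sph d)).Nonempty)
    (f := fun x => |R x|) (by fun_prop)
  have hmax : ∀ x, |R x| ≤ |R u0| := fun x => hu0 (Set.mem_univ x)
  set M := |R u0| with hM
  have hI0 : 0 ≤ ∫ x, |R x| ^ p ∂μ := integral_nonneg fun x => by positivity
  rcases (abs_nonneg (R u0)).eq_or_lt with h0 | h0
  · have : |R u| = 0 := le_antisymm (by rw [h0]; exact hmax u) (abs_nonneg _)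
    rw [this, Real.zero_rpow (by linarith)]
    positivity
  rw [← hM] at h0
  have hRk : R ^ k ∈ A1 d ^ (L * k) := by
    rw [pow_mul]; exact Submodule.pow_mem_pow _ hR k
  have h1 := nik2 d (L * k) (R ^ k) hRk u0
  have hint : ∀ f : Sph d → ℝ, Continuous f → Integrable f μ := fun f hf =>
    hf.integrable_of_hasCompactSupport (HasCompactSupport.of_compactSpace _)
  have e0 : M ^ (2 * (k:ℝ)) = M ^ p * M ^ (2 * (k:ℝ) - p) := by
    rw [← Real.rpow_add h0]; congr 1; ring
  have habs : ∀ x, ((R ^ k) x)^2 = |R x| ^ (2 * (k:ℝ)) := by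
    intro x
    have : (2 * (k:ℝ)) = ((2 * k : ℕ) : ℝ) := by push_cast; ring
    rw [this, Real.rpow_natCast, pow_mul, sq_abs, ContinuousMap.pow_apply]; ring
  have h2 : ∫ x, ((R ^ k) x)^2 ∂μ ≤ M ^ (2 * (k:ℝ) - p) * ∫ x, |R x| ^ p ∂μ := by
    rw [← integral_const_mul]
    refine integral_mono (hint _ (by fun_prop)) (hint _ ?_) ?_
    · exact continuous_const.mul (R.continuous.abs.rpow_const fun _ => Or.inr hp0)
    · intro x
      simp only
      rw [habs]
      have hkp : 0 < 2 * (k:ℝ) - p := by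
        have : (1:ℝ) ≤ k := by exact_mod_cast hk1
        linarith
      rcases (abs_nonneg (R x)).eq_or_lt with hx | hx
      · rw [← hx, Real.zero_rpow (by positivity)]; positivity
      · have : |R x| ^ (2 * (k:ℝ)) = |R x| ^ (2 * (k:ℝ) - p) * |R x| ^ p := by
          rw [← Real.rpow_add hx]; congr 1; ring
        rw [this]
        gcongr
        exact hmax x
  have hN : ((2 * (L * k + 1)^d : ℕ) : ℝ) ≤ 2 * (2 * (k:ℝ))^d * (L:ℝ)^d := by
    have : 2 * (L * k + 1)^d ≤ 2 * (2 * k)^d * L^d := by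
      rw [mul_assoc, ← mul_pow]
      gcongr
      nlinarith [Nat.mul_le_mul hL hk1]
    exact_mod_cast this
  rw [habs, ← hM, e0] at h1
  have hMp : 0 < M ^ (2 * (k:ℝ) - p) := Real.rpow_pos_of_pos h0 _
  have h3 : M ^ p * μ.real Set.univ ≤ 2 * (2 * (k:ℝ))^d * (L:ℝ)^d * ∫ x, |R x| ^ p ∂μ := by
    have h4 : M ^ (2 * (k:ℝ) - p) * (M ^ p * μ.real Set.univ) ≤
        M ^ (2 * (k:ℝ) - p) * (2 * (2 * (k:ℝ))^d * (L:ℝ)^d * ∫ x, |R x| ^ p ∂μ) := by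
      calc _ = M ^ p * M ^ (2 * (k:ℝ) - p) * μ.real Set.univ := by ring
        _ ≤ _ := h1
        _ ≤ (2 * (2 * (k:ℝ))^d * (L:ℝ)^d) * (M ^ (2 * (k:ℝ) - p) * ∫ x, |R x| ^ p ∂μ) := by
          gcongr
        _ = _ := by ring
    exact le_of_mul_le_mul_left h4 hMp
  calc |R u| ^ p ≤ M ^ p := by gcongr; exact hmax u
    _ ≤ (2 * (2 * (k:ℝ))^d * (L:ℝ)^d * ∫ x, |R x| ^ p ∂μ) / μ.real Set.univ := by
      rwa [le_div_iff₀ hμ0]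
    _ = _ := by ring

/-- Pointwise subharmonic-type bound: `|Q(u)|^p ≤ C L^{d+1} ∫_{B(u,1/L)} |Q|^p dm` for
`Q ∈ Π_L` and `u ∈ S^d`, and consequently `‖Q‖_∞^p ≤ C' L^d ‖Q‖_{L^p(S^d)}^p`. -/
theorem stmt14 (d : ℕ) (hd : 1 ≤ d) (p : ℝ) (hp : 1 ≤ p) :
    (∃ C : ℝ, 0 < C ∧ ∀ L : ℕ, 1 ≤ L → ∀ P ∈ harmPolyLe d L, ∀ u : Sph d,
      |eval (fun i => (u : Esp d) i) P| ^ p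
        ≤ C * (L : ℝ) ^ (d + 1) *
            ∫ x in Metric.ball (u : Esp d) (1 / L),
              |eval (fun i => x i) P| ^ p ∂(volume : Measure (Esp d))) ∧
    (∃ C' : ℝ, 0 < C' ∧ ∀ L : ℕ, 1 ≤ L → ∀ P ∈ harmPolyLe d L, ∀ u : Sph d,
      |eval (fun i => (u : Esp d) i) P| ^ p
        ≤ C' * (L : ℝ) ^ d *
            ∫ ω : Sph d, |eval (fun i => (ω : Esp d) i) P| ^ p ∂(sphMeasure d)) := by
  refine ⟨⟨(∫ x, wt d x)⁻¹, inv_pos.2 (wt_pos d), ?_⟩, ?_⟩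
  · intro L hL P hP u
    exact part1 d p hp P (harm_lap d L P hP) u L hL
  · have hk : 0 < (⌈p⌉₊ : ℝ) := by
      have := Nat.le_ceil p
      linarith
    have := sph_pos d
    refine ⟨2 * (2 * (⌈p⌉₊ : ℝ))^d / (sphMeasure d).real Set.univ, by positivity, ?_⟩
    intro L hL P hP u
    have := part2 d p hp L hL _ (aeval_mem d L P hP) u
    simpa only [aeval_apply'] using this

end
end
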